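/- arXiv:2306.03638 — 3 statements merged into one kernel-verified Lean document; each statement's English description precedes it below -/
import Mathlib

section
/- Let H be a real finite-dimensional inner product space, let l : H → ℝ be μ-strongly convex and M-smooth with minimizer w̄, and let h : H → ℝ ∪ {+∞} be proper, closed and convex, with w* the minimizer of l + h. Let (w^t) be generated by Prox-SGD with constant stepsize γ = A·log(T)/T, where 1/μ ≤ A, T is large enough that T/log(T) ≥ 2aA/μ, and conditionally on w^t the estimator g^t is a quadratically bounded estimator for ∇l at w^t with parameters (a, b, w*). Then E‖w^{T+1} − w*‖² ≤ (1/T)‖w⁰ − w*‖² + (2A·log(T)/(μT))(b + M²‖w* − w̄‖²). -/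
open MeasureTheory

section RealInequalities

lemma elimination_polynomial_nonneg {k r : ℝ} (hk0 : 0 ≤ k) (hk1 : k ≤ 1)
    (hr0 : 0 ≤ r) (hr1 : r ≤ 1) :
    0 ≤ (2 * (1 + k * r) * k - (3 / 2 + k * r / 2) * k ^ 2)
        * ((1 - k * r) * (1 + 2 * (k * r) - 2 * k - k ^ 2) + 2 * (k - k * r) * (3 + k * r))
      - 2 * (k - k * r) * (1 + k * r) ^ 3 := by
  have hk' : 0 ≤ 1 - k := by linarith
  have hr' : 0 ≤ 1 - r := by linarith
  have key : 0 ≤ k * (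
      (1 - k) ^ 5 * (2 * r * (1 - r) ^ 3 + 6 * r ^ 2 * (1 - r) ^ 2 + 6 * r ^ 3 * (1 - r)
        + 2 * r ^ 4)
      + k * (1 - k) ^ 4 * (13 / 2 * (1 - r) ^ 4 + 22 * r * (1 - r) ^ 3 + 33 * r ^ 2 * (1 - r) ^ 2
        + 26 * r ^ 3 * (1 - r) + 17 / 2 * r ^ 4)
      + k ^ 2 * (1 - k) ^ 3 * (18 * (1 - r) ^ 4 + 59 * r * (1 - r) ^ 3 + 69 * r ^ 2 * (1 - r) ^ 2
        + 39 * r ^ 3 * (1 - r) + 11 * r ^ 4)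
      + k ^ 3 * (1 - k) ^ 2 * (33 / 2 * (1 - r) ^ 4 + 63 * r * (1 - r) ^ 3
        + 141 / 2 * r ^ 2 * (1 - r) ^ 2 + 26 * r ^ 3 * (1 - r) + 4 * r ^ 4)
      + k ^ 4 * (1 - k) * (5 * (1 - r) ^ 4 + 26 * r * (1 - r) ^ 3 + 33 * r ^ 2 * (1 - r) ^ 2
        + 8 * r ^ 3 * (1 - r))
      + k ^ 5 * (2 * r * (1 - r) ^ 3 + 4 * r ^ 2 * (1 - r) ^ 2)) := by
    positivity
  exact key.trans_eq (by ring)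

/-- Elimination of the noise level between the one-step bound (for all admissible weights `f`)
and the bound coming from the variance constraint at the last iterate. -/
lemma le_of_step_bounds {s k b Q X : ℝ} (hs : 1 < s) (hk0 : 0 < k) (hk1 : k ≤ 1)
    (hb : 0 ≤ b) (hQ : 0 ≤ Q)
    (hvar : X ≤ (1 + k) * (X / (2 * s) + b) + (k ^ 2 + k) * Q)
    (hstep : ∀ f, 0 < f → f ≤ 3 / 2 * s - 1 → f ≤ 2 * s * k - (1 + s / 2) * k ^ 2 →
      f * X ≤ f * s ^ 2 * b + s ^ 2 * (s ^ 2 - f) * Q) :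
    X ≤ 2 * s * (b + Q) := by
  by_contra! hX
  have hs0 : 0 < s := by linarith
  have hvar' : X * (2 * s - 1 - k) ≤ 2 * s * ((1 + k) * b + (k ^ 2 + k) * Q) := by
    have h1 := mul_le_mul_of_nonneg_left hvar (by positivity : 0 ≤ 2 * s)
    have h2 : 2 * s * ((1 + k) * (X / (2 * s) + b) + (k ^ 2 + k) * Q)
        = (1 + k) * X + 2 * s * ((1 + k) * b + (k ^ 2 + k) * Q) := by
      field_simp
      ring
    linarith
  have hpos : 0 < 2 * s - 1 - k := by linarith
  have hlow : (2 * s - 1 - k) * (b + Q) < (1 + k) * b + (k ^ 2 + k) * Q := by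
    have h1 := mul_lt_mul_of_pos_right hX hpos
    have h2 : 2 * s * ((2 * s - 1 - k) * (b + Q)) < 2 * s * ((1 + k) * b + (k ^ 2 + k) * Q) := by
      linarith
    exact lt_of_mul_lt_mul_left h2 (by positivity)
  obtain hsk | hsk := le_or_gt k (s - 1)
  · have h1 : 0 ≤ (2 * (s - 1 - k)) * b := mul_nonneg (by linarith) hb
    have h2 : 0 ≤ (2 * (s - 1 - k) + (1 - k ^ 2)) * Q := by
      have : k ^ 2 ≤ 1 := pow_le_one₀ hk0.le hk1
      exact mul_nonneg (by linarith) hQ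
    linarith
  have hred : ∀ f, 0 < f → f ≤ 3 / 2 * s - 1 → f ≤ 2 * s * k - (1 + s / 2) * k ^ 2 →
      f * ((2 - s) * b + (2 + s) * Q) < s ^ 3 * Q := by
    intro f hf h1 h2
    have h3 := hstep f hf h1 h2
    have h4 := mul_lt_mul_of_pos_left hX hf
    have h5 : s * (f * ((2 - s) * b + (2 + s) * Q)) < s * (s ^ 3 * Q) := by linarith
    exact lt_of_mul_lt_mul_left h5 hs0.le
  have hs2 : s < 2 := by linarith
  have hfpos : 0 < 2 * s * k - (1 + s / 2) * k ^ 2 := by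
    have : 0 < k * (2 * s - (1 + s / 2) * k) := mul_pos hk0 (by nlinarith)
    linarith
  obtain hf | hf := le_total (3 / 2 * s - 1) (2 * s * k - (1 + s / 2) * k ^ 2)
  · have h1 := hred _ (by linarith) le_rfl hf
    have h2 : 0 ≤ (3 / 2 * s - 1) * ((2 - s) * b) :=
      mul_nonneg (by linarith) (mul_nonneg (by linarith) hb)
    have h3 : 0 ≤ ((2 - s) * (s ^ 2 + s / 2 - 1)) * Q :=
      mul_nonneg (mul_nonneg (by linarith) (by nlinarith)) hQ
    linarith
  · have h1 := hred _ hfpos hf le_rfl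
    obtain ⟨r, hr⟩ : ∃ r, s = 1 + k * r := ⟨(s - 1) / k, by field_simp; ring⟩
    have hr0 : 0 ≤ r := by
      by_contra! h
      have := mul_neg_of_pos_of_neg hk0 h
      linarith
    have hr1 : r ≤ 1 := by
      by_contra! h
      have := mul_lt_mul_of_pos_left h hk0
      linarith
    have h2 := mul_nonneg (elimination_polynomial_nonneg hk0.le hk1 hr0 hr1) hQ
    have h3 := mul_lt_mul_of_pos_left h1 (by linarith : 0 < 2 * (s - 1) * (-1) + 2 * k)
    have h4 := mul_le_mul_of_nonneg_left hlow.le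
      (mul_nonneg hfpos.le (by linarith : 0 ≤ 2 - s))
    subst hr
    linarith

lemma cone_inequality {s k f D Y c : ℝ} (hk0 : 0 < k) (hk1 : k ≤ 1) (hs : 0 < s)
    (hD : 0 ≤ D) (hf₁ : f ≤ 3 / 2 * s - 1) (hf₂ : f ≤ 2 * s * k - (1 + s / 2) * k ^ 2)
    (hDY : D ≤ Y) (hYD : k ^ 2 * Y ≤ D) (hc : D + k * Y ≤ (1 + k) * c) :
    (1 + s / 2) * D + f * Y ≤ 2 * s * c := by
  suffices h : (1 + k) * ((1 + s / 2) * D + f * Y) ≤ 2 * s * (D + k * Y) by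
    have h1 := mul_le_mul_of_nonneg_left hc (by positivity : 0 ≤ 2 * s)
    have h2 : (1 + k) * ((1 + s / 2) * D + f * Y) ≤ (1 + k) * (2 * s * c) := by linarith
    exact le_of_mul_le_mul_left h2 (by positivity)
  obtain rfl | hk := hk1.eq_or_lt
  · have : Y = D := by linarith
    subst this
    nlinarith
  · have hk2 : 0 < 1 - k ^ 2 := by nlinarith
    have h1 := mul_nonneg (sub_nonneg.2 hf₂) (sub_nonneg.2 hDY)
    have h2 := mul_nonneg (sub_nonneg.2 hf₁) (sub_nonneg.2 hYD)
    have h3 := mul_nonneg (by positivity : 0 ≤ 1 + k) (add_nonneg h1 h2)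
    have h4 : 0 ≤ (1 - k ^ 2) * (2 * s * (D + k * Y) - (1 + k) * ((1 + s / 2) * D + f * Y)) :=
      h3.trans_eq (by ring)
    have := nonneg_of_mul_nonneg_right h4 hk2
    linarith

end RealInequalities

section SmoothStronglyConvex

variable {H : Type*} [NormedAddCommGroup H] [InnerProductSpace ℝ H]

open scoped RealInnerProductSpace

lemma hasDerivAt_along_segment [CompleteSpace H] {l : H → ℝ} {l' : H → H}
    (hgrad : ∀ x, HasGradientAt l (l' x) x) (x v : H) (t : ℝ) :
    HasDerivAt (fun t : ℝ => l (x + t • v)) ⟪l' (x + t • v), v⟫ t := by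
  have h1 : HasDerivAt (fun t : ℝ => x + t • v) v t := by
    simpa using ((hasDerivAt_id t).smul_const v).const_add x
  simpa [Function.comp_def] using (hgrad (x + t • v)).hasFDerivAt.comp_hasDerivAt t h1

lemma le_quadratic_of_lipschitz_gradient [CompleteSpace H] {l : H → ℝ} {l' : H → H} {M : ℝ}
    (hgrad : ∀ x, HasGradientAt l (l' x) x)
    (hsmooth : ∀ x y, ‖l' x - l' y‖ ≤ M * ‖x - y‖) (x y : H) :
    l x ≤ l y + ⟪l' y, x - y⟫ + M / 2 * ‖x - y‖ ^ 2 := by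
  set v := x - y with hv
  let θ : ℝ → ℝ := fun t => l (y + t • v) - (t * ⟪l' y, v⟫ + t ^ 2 * (M / 2 * ‖v‖ ^ 2))
  have hθ : ∀ t, HasDerivAt θ (⟪l' (y + t • v), v⟫
      - (⟪l' y, v⟫ + 2 * t * (M / 2 * ‖v‖ ^ 2))) t := by
    intro t
    have h1 := hasDerivAt_along_segment hgrad y v t
    have h2 : HasDerivAt (fun t : ℝ => t * ⟪l' y, v⟫ + t ^ 2 * (M / 2 * ‖v‖ ^ 2))
        (⟪l' y, v⟫ + 2 * t * (M / 2 * ‖v‖ ^ 2)) t := by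
      exact (((hasDerivAt_id t).mul_const ⟪l' y, v⟫).add
        ((hasDerivAt_pow 2 t).mul_const (M / 2 * ‖v‖ ^ 2))).congr_deriv (by simp)
    exact h1.sub h2
  have hanti : AntitoneOn θ (Set.Icc 0 1) := by
    refine antitoneOn_of_deriv_nonpos (convex_Icc 0 1)
      (fun t _ => (hθ t).continuousAt.continuousWithinAt)
      (fun t _ => (hθ t).differentiableAt.differentiableWithinAt) fun t ht => ?_
    rw [interior_Icc] at ht
    rw [(hθ t).deriv]
    have h1 : ⟪l' (y + t • v) - l' y, v⟫ ≤ M * (t * ‖v‖) * ‖v‖ := by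
      refine (real_inner_le_norm _ _).trans ?_
      gcongr
      refine (hsmooth _ _).trans_eq ?_
      rw [add_sub_cancel_left, norm_smul, Real.norm_of_nonneg ht.1.le]
    rw [inner_sub_left] at h1
    linarith
  have h := hanti (Set.left_mem_Icc.2 zero_le_one) (Set.right_mem_Icc.2 zero_le_one) zero_le_one
  simp only [θ, one_smul, zero_smul, add_zero, hv, add_sub_cancel] at h
  linarith

lemma quadratic_le_of_strongly_convex [CompleteSpace H] {l : H → ℝ} {l' : H → H} {μ : ℝ}
    (hgrad : ∀ x, HasGradientAt l (l' x) x)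
    (hstrong : ConvexOn ℝ Set.univ (fun x => l x - μ / 2 * ‖x‖ ^ 2)) (x y : H) :
    l y + ⟪l' y, x - y⟫ + μ / 2 * ‖x - y‖ ^ 2 ≤ l x := by
  set v := x - y with hv
  have hx : x = y + v := by simp [hv]
  have hnorm : ∀ t : ℝ, ‖y + t • v‖ ^ 2 = ‖y‖ ^ 2 + t * (2 * ⟪y, v⟫) + t ^ 2 * ‖v‖ ^ 2 := by
    intro t
    rw [norm_add_sq_real, norm_smul, inner_smul_right, mul_pow, Real.norm_eq_abs, sq_abs]
    ring
  have hconv : ConvexOn ℝ Set.univ (fun t : ℝ => l (y + t • v) - μ / 2 * ‖y + t • v‖ ^ 2) := by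
    refine ⟨convex_univ, fun a _ b _ α β hα hβ hαβ => ?_⟩
    have h := hstrong.2 (Set.mem_univ (y + a • v)) (Set.mem_univ (y + b • v)) hα hβ hαβ
    have he : y + (α • a + β • b) • v = α • (y + a • v) + β • (y + b • v) := by
      have : y = (α + β) • y := by rw [hαβ, one_smul]
      nth_rewrite 1 [this]
      simp only [smul_eq_mul]
      module
    simp only [he]
    exact h
  have hder : HasDerivAt (fun t : ℝ => l (y + t • v) - μ / 2 * ‖y + t • v‖ ^ 2)
      (⟪l' y, v⟫ - μ / 2 * (2 * ⟪y, v⟫)) 0 := by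
    have h1 := hasDerivAt_along_segment hgrad y v 0
    simp only [zero_smul, add_zero] at h1
    have h2 : HasDerivAt (fun t : ℝ => μ / 2 * ‖y + t • v‖ ^ 2) (μ / 2 * (2 * ⟪y, v⟫)) 0 := by
      simp only [hnorm]
      simpa using ((((hasDerivAt_id (0 : ℝ)).mul_const (2 * ⟪y, v⟫)).const_add (‖y‖ ^ 2)).add
        ((hasDerivAt_pow 2 (0 : ℝ)).mul_const (‖v‖ ^ 2))).const_mul (μ / 2)
    exact h1.sub h2
  have h := hconv.le_slope_of_hasDerivAt (Set.mem_univ 0) (Set.mem_univ 1) one_pos hder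
  rw [slope_def_field] at h
  have h1 := hnorm 1
  rw [one_smul] at h1
  simp only [one_smul, zero_smul, add_zero, h1, sub_zero, div_one] at h
  rw [hx]
  linarith

/-- Strong monotonicity of the gradient. -/
lemma mul_sq_norm_le_inner_sub {l : H → ℝ} {l' : H → H} {μ : ℝ}
    (hlow : ∀ x y, l y + ⟪l' y, x - y⟫ + μ / 2 * ‖x - y‖ ^ 2 ≤ l x) (x y : H) :
    μ * ‖x - y‖ ^ 2 ≤ ⟪l' x - l' y, x - y⟫ := by
  have h1 := hlow x y
  have h2 := hlow y x
  rw [← neg_sub x y, inner_neg_right, norm_neg] at h2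
  rw [inner_sub_left]
  linarith

/-- Co-coercivity of the gradient of a smooth strongly convex function. -/
lemma coercivity_inner_sub {l : H → ℝ} {l' : H → H} {μ M : ℝ} (hμ : 0 < μ) (hμM : μ ≤ M)
    (hlow : ∀ x y, l y + ⟪l' y, x - y⟫ + μ / 2 * ‖x - y‖ ^ 2 ≤ l x)
    (hupp : ∀ x y, l x ≤ l y + ⟪l' y, x - y⟫ + M / 2 * ‖x - y‖ ^ 2)
    (hsmooth : ∀ x y, ‖l' x - l' y‖ ≤ M * ‖x - y‖) (x y : H) :
    μ * M * ‖x - y‖ ^ 2 + ‖l' x - l' y‖ ^ 2 ≤ (μ + M) * ⟪l' x - l' y, x - y⟫ := by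
  obtain rfl | hlt := hμM.eq_or_lt
  · have h1 := mul_sq_norm_le_inner_sub hlow x y
    have h2 := pow_le_pow_left₀ (norm_nonneg _) (hsmooth x y) 2
    nlinarith
  have hL : 0 < M - μ := by linarith
  have key : ∀ x y : H, ∀ τ : ℝ, l y + ⟪l' y, x - y⟫ + μ / 2 * ‖x - y‖ ^ 2
      + (τ - (M - μ) * τ ^ 2 / 2) * ‖l' x - l' y - μ • (x - y)‖ ^ 2 ≤ l x := by
    intro x y τ
    set G := l' x - l' y - μ • (x - y) with hG
    have h1 := hlow (x - τ • G) y
    have h2 := hupp (x - τ • G) x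
    have e1 : x - τ • G - y = (x - y) - τ • G := by abel
    have e2 : x - τ • G - x = -(τ • G) := by abel
    have e3 : ‖G‖ ^ 2 = ⟪l' x, G⟫ - ⟪l' y, G⟫ - μ * ⟪x - y, G⟫ := by
      rw [← real_inner_self_eq_norm_sq]
      nth_rewrite 1 [hG]
      rw [inner_sub_left, inner_sub_left, real_inner_smul_left]
    rw [e1, inner_sub_right, real_inner_smul_right, norm_sub_sq_real, real_inner_smul_right,
      norm_smul, mul_pow, Real.norm_eq_abs, sq_abs] at h1
    rw [e2, inner_neg_right, real_inner_smul_right, norm_neg,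
      norm_smul, mul_pow, Real.norm_eq_abs, sq_abs] at h2
    have h3 : τ * ‖G‖ ^ 2 = τ * (⟪l' x, G⟫ - ⟪l' y, G⟫ - μ * ⟪x - y, G⟫) := by rw [e3]
    linarith
  have h1 := key x y (1 / (M - μ))
  have h2 := key y x (1 / (M - μ))
  have e : l' y - l' x - μ • (y - x) = -(l' x - l' y - μ • (x - y)) := by module
  rw [e, norm_neg, ← neg_sub x y, inner_neg_right, norm_neg] at h2
  have h3 : ‖l' x - l' y - μ • (x - y)‖ ^ 2
      = ‖l' x - l' y‖ ^ 2 - 2 * μ * ⟪l' x - l' y, x - y⟫ + μ ^ 2 * ‖x - y‖ ^ 2 := by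
    rw [norm_sub_sq_real, real_inner_smul_right, norm_smul, mul_pow, Real.norm_eq_abs, sq_abs]
    ring
  have h4 : (1 / (M - μ)) * ‖l' x - l' y - μ • (x - y)‖ ^ 2
      ≤ ⟪l' x - l' y, x - y⟫ - μ * ‖x - y‖ ^ 2 := by
    have e5 : 1 / (M - μ) - (M - μ) * (1 / (M - μ)) ^ 2 / 2 = (1 / (M - μ)) / 2 := by
      field_simp
      ring
    rw [e5] at h1 h2
    rw [inner_sub_left]
    linarith
  rw [one_div, inv_mul_le_iff₀ hL, h3] at h4
  linarith

/-- First-order optimality condition for a composite minimization problem. -/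
lemma le_add_inner_of_composite_min {f : H → ℝ} {h : H → EReal} {C : ℝ} {x p : H}
    (hproper : ∃ v, h v ≠ ⊤) (hnobot : ∀ v, h v ≠ ⊥)
    (hconvex : ∀ x y : H, ∀ t : ℝ, 0 ≤ t → t ≤ 1 →
      h (t • x + (1 - t) • y) ≤ (t : EReal) * h x + ((1 - t : ℝ) : EReal) * h y)
    (hf : ∀ v, f v ≤ f x + ⟪p, v - x⟫ + C * ‖v - x‖ ^ 2)
    (hmin : ∀ v, (f x : EReal) + h x ≤ (f v : EReal) + h v) :
    ∃ c : ℝ, h x = c ∧ ∀ v (d : ℝ), h v = d → c ≤ d + ⟪p, v - x⟫ := by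
  obtain ⟨v₀, hv₀⟩ := hproper
  have hx : h x ≠ ⊤ := by
    intro htop
    have h1 := hmin v₀
    lift h v₀ to ℝ using ⟨hv₀, hnobot v₀⟩ with d
    rw [htop, EReal.coe_add_top, ← EReal.coe_add] at h1
    exact absurd (top_le_iff.1 h1) (EReal.coe_ne_top _)
  obtain ⟨c, hc⟩ : ∃ c : ℝ, h x = c := ⟨(h x).toReal, (EReal.coe_toReal hx (hnobot x)).symm⟩
  refine ⟨c, hc, fun v d hd => ?_⟩
  have key : ∀ t : ℝ, 0 < t → t ≤ 1 → c ≤ d + ⟪p, v - x⟫ + t * (C * ‖v - x‖ ^ 2) := by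
    intro t ht0 ht1
    have h1 := hconvex v x t ht0.le ht1
    have h2 := (hmin (t • v + (1 - t) • x)).trans (add_le_add_right h1 _)
    rw [hc, hd] at h2
    norm_cast at h2
    have h3 := hf (t • v + (1 - t) • x)
    have e : t • v + (1 - t) • x - x = t • (v - x) := by module
    rw [e, real_inner_smul_right, norm_smul, mul_pow, Real.norm_eq_abs, sq_abs] at h3
    have h4 : t * c ≤ t * (d + ⟪p, v - x⟫ + t * (C * ‖v - x‖ ^ 2)) := by linarith
    exact le_of_mul_le_mul_left h4 ht0
  have hlim : Filter.Tendsto (fun t : ℝ => d + ⟪p, v - x⟫ + t * (C * ‖v - x‖ ^ 2))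
      (nhdsWithin 0 (Set.Ioi 0)) (nhds (d + ⟪p, v - x⟫)) := by
    have : Continuous fun t : ℝ => d + ⟪p, v - x⟫ + t * (C * ‖v - x‖ ^ 2) := by fun_prop
    simpa using (this.tendsto 0).mono_left nhdsWithin_le_nhds
  refine ge_of_tendsto hlim ?_
  filter_upwards [Ioc_mem_nhdsGT one_pos] with t ht using key t ht.1 ht.2

/-- A proximal step is at least as close to a fixed point of the exact prox-gradient map as the
corresponding gradient step. -/
lemma norm_prox_sub_le {l : H → ℝ} {h : H → EReal} {C γ : ℝ} {p x z wstar : H} (hγ : 0 < γ)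
    (hproper : ∃ v, h v ≠ ⊤) (hnobot : ∀ v, h v ≠ ⊥)
    (hconvex : ∀ x y : H, ∀ t : ℝ, 0 ≤ t → t ≤ 1 →
      h (t • x + (1 - t) • y) ≤ (t : EReal) * h x + ((1 - t : ℝ) : EReal) * h y)
    (hl : ∀ v, l v ≤ l wstar + ⟪p, v - wstar⟫ + C * ‖v - wstar‖ ^ 2)
    (hmin : ∀ v, (l wstar : EReal) + h wstar ≤ (l v : EReal) + h v)
    (hprox : ∀ v, h x + ((‖z - x‖ ^ 2 / (2 * γ) : ℝ) : EReal)
      ≤ h v + ((‖z - v‖ ^ 2 / (2 * γ) : ℝ) : EReal)) :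
    ‖x - wstar‖ ≤ ‖z - wstar + γ • p‖ := by
  obtain ⟨c, hc, hc'⟩ := le_add_inner_of_composite_min hproper hnobot hconvex hl hmin
  obtain ⟨e, he, he'⟩ := le_add_inner_of_composite_min (f := fun v => ‖z - v‖ ^ 2 / (2 * γ))
    (x := x) (p := -(γ⁻¹ • (z - x))) (C := 1 / (2 * γ)) hproper hnobot hconvex
    (fun v => by
      have : z - v = (z - x) - (v - x) := by abel
      rw [this, norm_sub_sq_real, inner_neg_left, real_inner_smul_left]
      apply le_of_eq
      field_simp
      ring)
    (fun v => by
      rw [add_comm _ (h x), add_comm _ (h v)]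
      exact hprox v)
  have h1 := hc' x e he
  have h2 := he' wstar c hc
  rw [← neg_sub x wstar, inner_neg_right, inner_neg_left, neg_neg, real_inner_smul_left] at h2
  have h3 : 0 ≤ γ * ⟪p, x - wstar⟫ + ⟪z - x, x - wstar⟫ := by
    have : 0 ≤ γ * (⟪p, x - wstar⟫ + γ⁻¹ * ⟪z - x, x - wstar⟫) :=
      mul_nonneg hγ.le (by linarith)
    rwa [mul_add, mul_inv_cancel_left₀ hγ.ne'] at this
  have h4 : ‖x - wstar‖ ^ 2 ≤ ⟪z - wstar + γ • p, x - wstar⟫ := by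
    have e1 : z - wstar + γ • p = (z - x) + γ • p + (x - wstar) := by abel
    rw [e1, inner_add_left, inner_add_left, real_inner_smul_left, real_inner_self_eq_norm_sq]
    linarith
  have h5 := h4.trans (real_inner_le_norm _ _)
  by_contra! hlt
  nlinarith [norm_nonneg (x - wstar), norm_nonneg (z - wstar + γ • p)]

end SmoothStronglyConvex

lemma neg_two_inner_le {E : Type*} [NormedAddCommGroup E] [InnerProductSpace ℝ E] {α : ℝ}
    (hα : 0 < α) (u v : E) : -(2 * inner ℝ u v) ≤ α * ‖u‖ ^ 2 + α⁻¹ * ‖v‖ ^ 2 := by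
  have h1 : 0 ≤ α⁻¹ * ‖α • u + v‖ ^ 2 := by positivity
  rw [norm_add_sq_real, real_inner_smul_left, norm_smul, mul_pow, Real.norm_eq_abs, sq_abs] at h1
  have h2 : α⁻¹ * (α ^ 2 * ‖u‖ ^ 2 + 2 * (α * inner ℝ u v) + ‖v‖ ^ 2)
      = α * ‖u‖ ^ 2 + 2 * inner ℝ u v + α⁻¹ * ‖v‖ ^ 2 := by
    field_simp
  rw [h2] at h1
  linarith

section ConditionalMoments

lemma integral_le_of_condExp_le {Ω : Type*} {m m₀ : MeasurableSpace Ω} {P : Measure Ω}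
    (hm : m ≤ m₀) [SigmaFinite (P.trim hm)] {f q : Ω → ℝ} (hq : Integrable q P)
    (hle : P[f | m] ≤ᵐ[P] q) :
    ∫ ω, f ω ∂P ≤ ∫ ω, q ω ∂P := by
  rw [← integral_condExp hm]
  exact integral_mono_ae integrable_condExp hq hle

variable {H : Type*} [NormedAddCommGroup H] [InnerProductSpace ℝ H]
  {Ω : Type*} [MeasurableSpace Ω] {P : Measure Ω}

open scoped RealInnerProductSpace

lemma integrable_inner_of_memLp_two {f g : Ω → H} (hf : MemLp f 2 P) (hg : MemLp g 2 P) :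
    Integrable (fun ω => ⟪f ω, g ω⟫) P :=
  (hf.norm.integrable_mul hg.norm).mono' (hf.1.inner hg.1)
    (Filter.Eventually.of_forall fun _ => norm_inner_le_norm _ _)

variable [FiniteDimensional ℝ H] [MeasurableSpace H] [BorelSpace H] [IsProbabilityMeasure P]

lemma integral_inner_eq_of_condExp {w g : Ω → H} {u φ : H → H} (hw : Measurable w)
    (hφ : Measurable φ) (hg : MemLp g 2 P) (hφ₂ : MemLp (fun ω => φ (w ω)) 2 P)
    (hunbiased : P[g | MeasurableSpace.comap w ‹MeasurableSpace H›] =ᵐ[P] fun ω => u (w ω)) :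
    ∫ ω, ⟪φ (w ω), g ω⟫ ∂P = ∫ ω, ⟪φ (w ω), u (w ω)⟫ ∂P := by
  have hφm : StronglyMeasurable[MeasurableSpace.comap w ‹MeasurableSpace H›]
      (fun ω => φ (w ω)) :=
    (hφ.comp (comap_measurable w)).stronglyMeasurable
  have h := condExp_bilin_of_stronglyMeasurable_left (innerSL ℝ) hφm
    (integrable_inner_of_memLp_two hφ₂ hg) (hg.integrable one_le_two)
  rw [← integral_condExp hw.comap_le]
  refine integral_congr_ae ?_
  filter_upwards [h, hunbiased] with ω h1 h2
  rw [← h2]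
  exact h1

lemma integral_sq_norm_condExp_le {w g : Ω → H} {u : H → H} (hw : Measurable w)
    (hu : Measurable u) (hg : MemLp g 2 P) (hu₂ : MemLp (fun ω => u (w ω)) 2 P)
    (hunbiased : P[g | MeasurableSpace.comap w ‹MeasurableSpace H›] =ᵐ[P] fun ω => u (w ω)) :
    ∫ ω, ‖u (w ω)‖ ^ 2 ∂P ≤ ∫ ω, ‖g ω‖ ^ 2 ∂P := by
  have h := integral_inner_eq_of_condExp hw hu hg hu₂ hunbiased
  simp only [real_inner_self_eq_norm_sq] at h
  have hug := integrable_inner_of_memLp_two hu₂ hg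
  have hgg := hg.integrable_norm_pow two_ne_zero
  have huu := hu₂.integrable_norm_pow two_ne_zero
  have h1 : 2 * ∫ ω, ⟪u (w ω), g ω⟫ ∂P ≤ ∫ ω, ‖u (w ω)‖ ^ 2 + ‖g ω‖ ^ 2 ∂P := by
    rw [← integral_const_mul]
    refine integral_mono (hug.const_mul 2) (huu.add hgg) fun ω => ?_
    have := norm_sub_sq_real (u (w ω)) (g ω)
    simp only
    nlinarith [sq_nonneg ‖u (w ω) - g ω‖]
  rw [integral_add huu hgg] at h1
  linarith

/-- One step of a stochastic gradient method in expectation: a pointwise bound on the drift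
yields a bound on the expected squared distance. -/
lemma integral_sq_norm_step_le {w g x : Ω → H} {u : H → H} {p wstar : H} {γ A B C : ℝ}
    (hC : 0 ≤ C) (hw : Measurable w) (hu : Measurable u) (hg : MemLp g 2 P)
    (hd : MemLp (fun ω => w ω - wstar) 2 P) (hu₂ : MemLp (fun ω => u (w ω)) 2 P)
    (hx : Integrable (fun ω => ‖x ω - wstar‖ ^ 2) P)
    (hunbiased : P[g | MeasurableSpace.comap w ‹MeasurableSpace H›] =ᵐ[P] fun ω => u (w ω))
    (hstep : ∀ ω, ‖x ω - wstar‖ ≤ ‖w ω - γ • g ω - wstar + γ • p‖)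
    (hdrift : ∀ y, ‖y - wstar‖ ^ 2 - 2 * γ * ⟪y - wstar, u y - p⟫
      - γ ^ 2 * (2 * ⟪u y, p⟫ - ‖p‖ ^ 2) ≤ A * ‖y - wstar‖ ^ 2 + C * ‖u y‖ ^ 2 + B) :
    ∫ ω, ‖x ω - wstar‖ ^ 2 ∂P
      ≤ A * ∫ ω, ‖w ω - wstar‖ ^ 2 ∂P + (γ ^ 2 + C) * ∫ ω, ‖g ω‖ ^ 2 ∂P + B := by
  let φ : H → H := fun y => γ • (y - wstar) + γ ^ 2 • p
  have hφ : Measurable φ := by fun_prop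
  have hφ₂ : MemLp (fun ω => φ (w ω)) 2 P := (hd.const_smul γ).add (memLp_const _)
  have hcross := integral_inner_eq_of_condExp hw hφ hg hφ₂ hunbiased
  have hjensen := mul_le_mul_of_nonneg_left (integral_sq_norm_condExp_le hw hu hg hu₂ hunbiased) hC
  have i1 := integrable_inner_of_memLp_two hφ₂ hg
  have i2 := integrable_inner_of_memLp_two hφ₂ hu₂
  have i3 := hg.integrable_norm_pow two_ne_zero
  have i4 := hu₂.integrable_norm_pow two_ne_zero
  have i5 := hd.integrable_norm_pow two_ne_zero
  have hpt : ∀ ω, ‖x ω - wstar‖ ^ 2 ≤ A * ‖w ω - wstar‖ ^ 2 + C * ‖u (w ω)‖ ^ 2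
      + γ ^ 2 * ‖g ω‖ ^ 2 + B + (2 * ⟪φ (w ω), u (w ω)⟫ - 2 * ⟪φ (w ω), g ω⟫) := by
    intro ω
    refine (pow_le_pow_left₀ (norm_nonneg _) (hstep ω) 2).trans ?_
    have e : w ω - γ • g ω - wstar + γ • p = (w ω - wstar) - γ • (g ω - p) := by module
    have h := hdrift (w ω)
    rw [e, norm_sub_sq_real, norm_smul, mul_pow, Real.norm_eq_abs, sq_abs, norm_sub_sq_real (g ω)]
    simp only [φ, inner_add_left, real_inner_smul_left, real_inner_smul_right, inner_sub_right]
      at h ⊢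
    rw [real_inner_comm p (g ω)]
    rw [real_inner_comm p (u (w ω))] at h
    linarith
  have hint := integral_mono hx (((((i5.const_mul A).add (i4.const_mul C)).add
    (i3.const_mul (γ ^ 2))).add (integrable_const B)).add ((i2.const_mul 2).sub (i1.const_mul 2)))
    hpt
  refine hint.trans ?_
  simp only [Pi.add_apply, Pi.sub_apply]
  rw [integral_add, integral_add, integral_add, integral_add, integral_sub,
    integral_const_mul, integral_const_mul, integral_const_mul, integral_const_mul,
    integral_const_mul, hcross]
  · simp only [integral_const, probReal_univ, smul_eq_mul, one_mul]
    linarith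
  all_goals fun_prop

end ConditionalMoments

/-- **Prox-SGD, strongly convex case, `log T / T` stepsize.**
If the constant stepsize is `γ = A log T / T` with `1/μ ≤ A` and `T/log T ≥ 2aA/μ`, then
`E‖w (T+1) − wstar‖² ≤ (1/T)‖w 0 − wstar‖² + (2A log T/(μT))(b + M²‖wstar − wbar‖²)`. -/
theorem prox_sgd_strongly_convex_logT_stepsize
    {H : Type*} [NormedAddCommGroup H] [InnerProductSpace ℝ H]
    [FiniteDimensional ℝ H] [MeasurableSpace H] [BorelSpace H]
    {Ω : Type*} [MeasurableSpace Ω] (P : Measure Ω) [IsProbabilityMeasure P]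
    (l : H → ℝ) (l' : H → H) (h : H → EReal)
    (μ M a b γ A : ℝ) (T : ℕ) (wbar wstar w0 : H)
    (w g : ℕ → Ω → H)
    (hμ : 0 < μ) (hM : 0 < M) (ha : 0 < a) (hb : 0 ≤ b)
    -- `l` is differentiable with gradient `l'`
    (hgrad : ∀ x, HasGradientAt l (l' x) x)
    -- `l` is `μ`-strongly convex
    (hstrong : ConvexOn ℝ Set.univ (fun x => l x - μ / 2 * ‖x‖ ^ 2))
    -- `l` is `M`-smooth
    (hsmooth : ∀ x y, ‖l' x - l' y‖ ≤ M * ‖x - y‖)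
    -- `wbar` is the minimizer of `l`
    (hlmin : ∀ v, l wbar ≤ l v)
    -- `h` is proper, closed and convex
    (hproper : ∃ v, h v ≠ ⊤) (hnobot : ∀ v, h v ≠ ⊥)
    (hclosed : LowerSemicontinuous h)
    (hconvex : ∀ x y : H, ∀ t : ℝ, 0 ≤ t → t ≤ 1 →
      h (t • x + (1 - t) • y) ≤ (t : EReal) * h x + ((1 - t : ℝ) : EReal) * h y)
    -- `wstar` is the minimizer of `l + h`
    (hmin : ∀ v, (l wstar : EReal) + h wstar ≤ (l v : EReal) + h v)
    -- constant stepsize `γ = A log T / T` with `1/μ ≤ A` and `T / log T ≥ 2aA/μ`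
    (hT : 1 ≤ T)
    (hγdef : γ = A * Real.log T / T)
    (hA : 1 / μ ≤ A)
    (hTlarge : 2 * a * A / μ ≤ (T : ℝ) / Real.log T)
    -- deterministic initialization
    (hw0 : ∀ ω, w 0 ω = w0)
    -- Prox-SGD iterates: `w (t+1) = prox_{γ h} (w t - γ • g t)`
    (hiter : ∀ t ω, ∀ v : H,
      h (w (t + 1) ω) + ((‖w t ω - γ • g t ω - w (t + 1) ω‖ ^ 2 / (2 * γ) : ℝ) : EReal)
        ≤ h v + ((‖w t ω - γ • g t ω - v‖ ^ 2 / (2 * γ) : ℝ) : EReal))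
    -- measurability and integrability
    (hwmeas : ∀ t, Measurable (w t))
    (hgmeas : ∀ t, Measurable (g t))
    (hgint : ∀ t, Integrable (g t) P)
    (hgsqint : ∀ t, Integrable (fun ω => ‖g t ω‖ ^ 2) P)
    (hwsqint : ∀ t, Integrable (fun ω => ‖w t ω - wstar‖ ^ 2) P)
    -- conditionally on `w t`, `g t` is an unbiased estimator of `∇ l (w t)` ...
    (hunbiased : ∀ t, P[g t | MeasurableSpace.comap (w t) ‹MeasurableSpace H›]
        =ᵐ[P] fun ω => l' (w t ω))
    -- ... whose expected squared norm is quadratically bounded with parameters `(a, b, wstar)`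
    (hnoise : ∀ t, P[(fun ω => ‖g t ω‖ ^ 2) | MeasurableSpace.comap (w t) ‹MeasurableSpace H›]
        ≤ᵐ[P] fun ω => a * ‖w t ω - wstar‖ ^ 2 + b) :
    ∫ ω, ‖w (T + 1) ω - wstar‖ ^ 2 ∂P
      ≤ 1 / (T : ℝ) * ‖w0 - wstar‖ ^ 2
        + 2 * A * Real.log T / (μ * T) * (b + M ^ 2 * ‖wstar - wbar‖ ^ 2) := by
  have hT0 : (0 : ℝ) < T := by exact_mod_cast hT
  have hA0 : 0 < A := (one_div_pos.2 hμ).trans_le hA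
  have hlog : 0 < Real.log T := by
    by_contra! hle
    have h1 : (T : ℝ) / Real.log T ≤ 0 := div_nonpos_of_nonneg_of_nonpos hT0.le hle
    have h2 : 0 < 2 * a * A / μ := by positivity
    linarith
  have hγ : 0 < γ := by rw [hγdef]; positivity
  have haγ : a * γ ≤ μ / 2 := by
    rw [div_le_div_iff₀ hμ hlog] at hTlarge
    rw [hγdef, ← mul_div_assoc, div_le_iff₀ hT0]
    linarith
  have hlogT : Real.log T ≤ γ * μ * T := by
    rw [div_le_iff₀ hμ] at hA
    have : γ * μ * T = A * μ * Real.log T := by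
      rw [hγdef]
      field_simp
    rw [this]
    exact le_mul_of_one_le_left hlog.le hA
  have hlow := quadratic_le_of_strongly_convex hgrad hstrong
  have hupp := le_quadratic_of_lipschitz_gradient hgrad hsmooth
  have hmono := mul_sq_norm_le_inner_sub hlow
  set p := l' wstar with hp
  set Q := M ^ 2 * ‖wstar - wbar‖ ^ 2 with hQ
  have hQ0 : 0 ≤ Q := by positivity
  have hrhs : 2 * A * Real.log T / (μ * T) * (b + Q) = 2 * (γ / μ) * (b + Q) := by
    rw [hγdef]
    field_simp
  rw [hrhs]
  have hlbar : l' wbar = 0 := by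
    have h1 : IsLocalMin l wbar := Filter.Eventually.of_forall hlmin
    simpa using h1.hasFDerivAt_eq_zero (hgrad wbar).hasFDerivAt
  have hpQ : ‖p‖ ^ 2 ≤ Q := by
    have h1 := hsmooth wstar wbar
    rw [hlbar, sub_zero] at h1
    exact (pow_le_pow_left₀ (norm_nonneg _) h1 2).trans_eq (mul_pow _ _ _)
  have hl'lip : LipschitzWith M.toNNReal l' := LipschitzWith.of_dist_le_mul fun x y => by
    rw [dist_eq_norm, dist_eq_norm, Real.coe_toNNReal _ hM.le]
    exact hsmooth x y
  have hl'meas : Measurable l' := hl'lip.continuous.measurable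
  have hg₂ : ∀ t, MemLp (g t) 2 P := fun t =>
    (memLp_two_iff_integrable_sq_norm (hgmeas t).aestronglyMeasurable).2 (hgsqint t)
  have hd₂ : ∀ t, MemLp (fun ω => w t ω - wstar) 2 P := fun t =>
    (memLp_two_iff_integrable_sq_norm
      ((hwmeas t).sub_const wstar).aestronglyMeasurable).2 (hwsqint t)
  have hu₂ : ∀ t, MemLp (fun ω => l' (w t ω)) 2 P := by
    intro t
    have h1 : MemLp (fun ω => l' (w t ω) - p) 2 P :=
      (hd₂ t).of_le_mul
        ((hl'meas.comp (hwmeas t)).sub_const p).aestronglyMeasurable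
        (Filter.Eventually.of_forall fun ω => hsmooth _ _)
    have h2 : (fun ω => l' (w t ω)) = (fun ω => l' (w t ω) - p) + fun _ => p := by
      ext ω
      simp
    rw [h2]
    exact h1.add (memLp_const p)
  set D : ℕ → ℝ := fun t => ∫ ω, ‖w t ω - wstar‖ ^ 2 ∂P with hD
  have hD0 : ∀ t, 0 ≤ D t := fun t => integral_nonneg fun ω => by positivity
  have hG : ∀ t, ∫ ω, ‖g t ω‖ ^ 2 ∂P ≤ a * D t + b := by
    intro t
    refine (integral_le_of_condExp_le (hwmeas t).comap_le
      (((hwsqint t).const_mul a).add (integrable_const b)) (hnoise t)).trans_eq ?_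
    simp only [Pi.add_apply]
    rw [integral_add ((hwsqint t).const_mul a) (integrable_const b), integral_const_mul]
    simp [hD]
  have hprox : ∀ t ω, ‖w (t + 1) ω - wstar‖ ≤ ‖w t ω - γ • g t ω - wstar + γ • p‖ :=
    fun t ω => norm_prox_sub_le hγ hproper hnobot hconvex (fun v => hupp v wstar) hmin (hiter t ω)
  have hstep := fun t (A' B' C' : ℝ) (hC' : 0 ≤ C') =>
    integral_sq_norm_step_le (A := A') (B := B') hC' (hwmeas t) hl'meas (hg₂ t) (hd₂ t) (hu₂ t)
      (hwsqint (t + 1)) (hunbiased t) (hprox t)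
  obtain hs | hs := le_or_gt (γ * μ) 1
  · have hrec : ∀ t, D (t + 1) ≤ (1 - γ * μ) * D t + 2 * γ ^ 2 * (b + Q) := by
      intro t
      have h1 := hstep t (1 - 2 * γ * μ) (2 * γ ^ 2 * ‖p‖ ^ 2) (γ ^ 2) (by positivity) fun y => by
        have h2 := mul_le_mul_of_nonneg_left (hmono y wstar) (by positivity : 0 ≤ 2 * γ)
        rw [real_inner_comm] at h2
        have h3 : 0 ≤ γ ^ 2 * ‖l' y + p‖ ^ 2 := by positivity
        rw [norm_add_sq_real] at h3
        linarith
      have h2 := mul_le_mul_of_nonneg_left (hG t) (by positivity : 0 ≤ γ ^ 2 + γ ^ 2)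
      have h3 := mul_le_mul_of_nonneg_right haγ (mul_nonneg hγ.le (hD0 t))
      have h4 := mul_le_mul_of_nonneg_left hpQ (by positivity : 0 ≤ 2 * γ ^ 2)
      simp only [hD] at h1 h2 h3 ⊢
      linarith
    have hind : ∀ t, D t ≤ (1 - γ * μ) ^ t * ‖w0 - wstar‖ ^ 2 + 2 * (γ / μ) * (b + Q) := by
      intro t
      induction t with
      | zero =>
        have : D 0 = ‖w0 - wstar‖ ^ 2 := by simp [hD, hw0]
        rw [this, pow_zero, one_mul]
        exact le_add_of_nonneg_right (by positivity)
      | succ t ih =>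
        refine (hrec t).trans ((add_le_add_left
          (mul_le_mul_of_nonneg_left ih (sub_nonneg.2 hs)) _).trans_eq ?_)
        field_simp
        ring
    refine (hind (T + 1)).trans ?_
    gcongr
    have h1 : (1 - γ * μ) ^ (T + 1) ≤ (1 - γ * μ) ^ T :=
      pow_le_pow_of_le_one (sub_nonneg.2 hs) (by nlinarith) T.le_succ
    have h2 : (1 - γ * μ) ^ T ≤ Real.exp (-(γ * μ)) ^ T :=
      pow_le_pow_left₀ (sub_nonneg.2 hs) (by linarith [Real.add_one_le_exp (-(γ * μ))]) T
    refine (h1.trans h2).trans ?_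
    have h3 : 1 / (T : ℝ) = Real.exp (-Real.log T) := by
      rw [Real.exp_neg, Real.exp_log hT0, one_div]
    rw [h3, ← Real.exp_nat_mul, Real.exp_le_exp]
    linarith
  · suffices hfin : D (T + 1) ≤ 2 * (γ / μ) * (b + Q) from
      hfin.trans (le_add_of_nonneg_left (by positivity))
    obtain hMμ | hμM := lt_or_ge M μ
    · have hzero : ∀ y, ‖y - wstar‖ ^ 2 = 0 := by
        intro y
        have h1 := (hmono y wstar).trans (real_inner_le_norm _ _)
        have h2 := mul_le_mul_of_nonneg_right (hsmooth y wstar) (norm_nonneg (y - wstar))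
        nlinarith [sq_nonneg ‖y - wstar‖]
      have : D (T + 1) = 0 := by simp only [hD, hzero, integral_zero]
      rw [this]
      positivity
    set k := μ / M with hk
    have hk0 : 0 < k := div_pos hμ hM
    have hk1 : k ≤ 1 := (div_le_one hM).2 hμM
    have hkM : k * M = μ := div_mul_cancel₀ _ hM.ne'
    have hcomp : μ ^ 2 * D (T + 1) ≤ 2 * (γ * μ) * (b + Q) := by
      refine le_of_step_bounds hs hk0 hk1 hb hQ0 ?_ ?_
      · have h1 : ∀ y, μ ^ 2 * ‖y - wstar‖ ^ 2 ≤ (1 + k) * ‖l' y‖ ^ 2 + (k ^ 2 + k) * Q := by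
          intro y
          have h2 : μ * ‖y - wbar‖ ≤ ‖l' y‖ := by
            have h3 := (hmono y wbar).trans (real_inner_le_norm _ _)
            rw [hlbar, sub_zero] at h3
            obtain h4 | h4 := (norm_nonneg (y - wbar)).eq_or_lt
            · rw [← h4, mul_zero]
              exact norm_nonneg _
            · refine le_of_mul_le_mul_right ?_ h4
              linarith
          have h5 : μ * ‖y - wstar‖ ≤ ‖l' y‖ + μ * ‖wstar - wbar‖ := by
            have h6 : ‖y - wstar‖ ≤ ‖y - wbar‖ + ‖wstar - wbar‖ := by
              have : y - wstar = (y - wbar) - (wstar - wbar) := by abel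
              rw [this]
              exact norm_sub_le _ _
            have := mul_le_mul_of_nonneg_left h6 hμ.le
            linarith
          have h7 := pow_le_pow_left₀ (by positivity) h5 2
          have h8 : 0 ≤ k * (‖l' y‖ - M * ‖wstar - wbar‖) ^ 2 := by positivity
          rw [← hkM] at h7 ⊢
          rw [hQ]
          linarith
        have h2 : μ ^ 2 * D (T + 1)
            ≤ (1 + k) * ∫ ω, ‖l' (w (T + 1) ω)‖ ^ 2 ∂P + (k ^ 2 + k) * Q := by
          have hui := (hu₂ (T + 1)).integrable_norm_pow two_ne_zero
          have h3 := integral_mono ((hwsqint (T + 1)).const_mul (μ ^ 2))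
            ((hui.const_mul (1 + k)).add (integrable_const ((k ^ 2 + k) * Q)))
            fun ω => h1 (w (T + 1) ω)
          simp only [Pi.add_apply] at h3
          rw [integral_add (hui.const_mul (1 + k)) (integrable_const _), integral_const_mul,
            integral_const_mul] at h3
          simpa using h3
        have h3 := (integral_sq_norm_condExp_le (hwmeas (T + 1)) hl'meas (hg₂ (T + 1))
          (hu₂ (T + 1)) (hunbiased (T + 1))).trans (hG (T + 1))
        have h4 : a * D (T + 1) ≤ μ ^ 2 * D (T + 1) / (2 * (γ * μ)) := by
          rw [le_div_iff₀ (by positivity)]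
          have := mul_le_mul_of_nonneg_right haγ (mul_nonneg hμ.le (hD0 (T + 1)))
          linarith
        have h5 := mul_le_mul_of_nonneg_left (h3.trans (add_le_add_left h4 b))
          (by positivity : 0 ≤ 1 + k)
        linarith
      · intro f hf hf₁ hf₂
        set s := γ * μ with hs'
        have hs0 : 0 < s := by positivity
        have hfs : f ≤ s ^ 2 := by nlinarith [sq_nonneg (s - 3 / 4)]
        have hα0 : 0 < f / s ^ 2 := by positivity
        have h1 := hstep T (-(s / 2)) (γ ^ 2 * ((s ^ 2 / f - 1) * ‖p‖ ^ 2)) 0 le_rfl fun y => by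
          have hYD : ‖l' y - p‖ ^ 2 ≤ M ^ 2 * ‖y - wstar‖ ^ 2 :=
            (pow_le_pow_left₀ (norm_nonneg _) (hsmooth y wstar) 2).trans_eq (mul_pow _ _ _)
          have hDY : μ ^ 2 * ‖y - wstar‖ ^ 2 ≤ ‖l' y - p‖ ^ 2 := by
            have h4 := (hmono y wstar).trans (real_inner_le_norm _ _)
            obtain h5 | h5 := (norm_nonneg (y - wstar)).eq_or_lt
            · rw [← h5]
              simp
            · rw [← mul_pow]
              refine pow_le_pow_left₀ (by positivity) (le_of_mul_le_mul_right ?_ h5) 2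
              linarith
          have hco := coercivity_inner_sub hμ hμM hlow hupp hsmooth y wstar
          rw [real_inner_comm] at hco
          have hcone := cone_inequality (D := μ ^ 2 * ‖y - wstar‖ ^ 2)
            (Y := ‖l' y - p‖ ^ 2) (c := μ * inner ℝ (y - wstar) (l' y - p)) hk0 hk1 hs0
            (by positivity) hf₁ hf₂ hDY
            (by
              rw [← hkM]
              have := mul_le_mul_of_nonneg_left hYD (by positivity : 0 ≤ k ^ 2)
              linarith)
            (by
              have h2 := mul_le_mul_of_nonneg_left hco hk0.le
              have h3 : k * (μ * M * ‖y - wstar‖ ^ 2 + ‖l' y - p‖ ^ 2)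
                  = μ ^ 2 * ‖y - wstar‖ ^ 2 + k * ‖l' y - p‖ ^ 2 := by
                rw [← hkM]
                ring
              have h4 : k * ((μ + M) * inner ℝ (y - wstar) (l' y - p))
                  = (1 + k) * (μ * inner ℝ (y - wstar) (l' y - p)) := by
                rw [← hkM]
                ring
              rw [← h3, ← h4]
              exact h2)
          have hyoung : -(2 * inner ℝ (l' y - p) p)
              ≤ f / s ^ 2 * ‖l' y - p‖ ^ 2 + s ^ 2 / f * ‖p‖ ^ 2 := by
            rw [← inv_div f]
            exact neg_two_inner_le hα0 _ _
          have hup : inner ℝ (l' y) p = inner ℝ (l' y - p) p + ‖p‖ ^ 2 := by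
            rw [inner_sub_left, real_inner_self_eq_norm_sq]
            ring
          rw [hup]
          have h2 := mul_le_mul_of_nonneg_left hyoung (sq_nonneg γ)
          have h3 : (1 + s / 2) * ‖y - wstar‖ ^ 2 + γ ^ 2 * (f / s ^ 2 * ‖l' y - p‖ ^ 2)
              ≤ 2 * γ * inner ℝ (y - wstar) (l' y - p) := by
            refine le_of_mul_le_mul_left ?_ (by positivity : 0 < μ ^ 2)
            have h4 : μ ^ 2 * (γ ^ 2 * (f / s ^ 2 * ‖l' y - p‖ ^ 2)) = f * ‖l' y - p‖ ^ 2 := by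
              rw [hs']
              field_simp
            rw [mul_add, h4]
            have h5 : 2 * s * (μ * inner ℝ (y - wstar) (l' y - p))
                = μ ^ 2 * (2 * γ * inner ℝ (y - wstar) (l' y - p)) := by
              rw [hs']
              ring
            linarith
          linarith
        have h2 := mul_le_mul_of_nonneg_left (hG T) (by positivity : 0 ≤ γ ^ 2)
        have h3 := mul_le_mul_of_nonneg_right haγ (mul_nonneg hγ.le (hD0 T))
        have h4 : D (T + 1) ≤ γ ^ 2 * b + γ ^ 2 * ((s ^ 2 / f - 1) * ‖p‖ ^ 2) := by
          simp only [hD] at h1 h2 h3 ⊢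
          rw [hs'] at h1 ⊢
          linarith
        have h5 : (s ^ 2 / f - 1) * ‖p‖ ^ 2 ≤ (s ^ 2 / f - 1) * Q :=
          mul_le_mul_of_nonneg_left hpQ (sub_nonneg.2 ((one_le_div hf).2 hfs))
        have h6 := h4.trans (add_le_add_right
          (mul_le_mul_of_nonneg_left h5 (sq_nonneg γ)) _)
        have h7 := mul_le_mul_of_nonneg_left h6 (by positivity : 0 ≤ f * μ ^ 2)
        have h8 : f * μ ^ 2 * (γ ^ 2 * b + γ ^ 2 * ((s ^ 2 / f - 1) * Q))
            = f * s ^ 2 * b + s ^ 2 * (s ^ 2 - f) * Q := by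
          rw [hs']
          field_simp
        linarith
    have h1 : μ ^ 2 * (2 * (γ / μ) * (b + Q)) = 2 * (γ * μ) * (b + Q) := by
      field_simp
    rw [← h1] at hcomp
    exact le_of_mul_le_mul_left hcomp (by positivity)
end

section
/- Let H be a real finite-dimensional inner product space, let l : H → ℝ be convex and M-smooth, let h : H → ℝ ∪ {+∞} be proper, closed and convex, set f = l + h and let w* ∈ argmin f. Let (w^t) be generated by Prox-SGD with constant stepsize γ ∈ (0, 1/M], where conditionally on w^t the estimator g^t is a quadratically bounded estimator for ∇l at w^t with parameters (a, b, w*). Define θ = 1/(1 + 2aγ²) and the weighted average w̄^T = (Σ_{t=1}^T θ^{t+1} w^t)/(Σ_{t=1}^T θ^{t+1}). Then E[f(w̄^T) − inf f] ≤ γ(a‖w⁰ − w*‖²/(1 − θ^T) + b). Moreover, if γ = 1/√(aT) then for all T ≥ max{M²/a, 2}, E[f(w̄^T)] − inf f ≤ (1/√(aT))(2a‖w⁰ − w*‖² + b). -/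
open MeasureTheory

/-- The expectation of a nonnegative extended-real quantity, as an `ℝ≥0∞`-valued object. -/
noncomputable def erealToENNReal (x : EReal) : ENNReal :=
  if x = ⊤ then ⊤ else ENNReal.ofReal x.toReal

open scoped RealInnerProductSpace

section Deterministic

variable {H : Type*} [NormedAddCommGroup H] [InnerProductSpace ℝ H]

/-- First-order condition: a convex function that is bounded below, up to a quadratic error, by an
affine function touching it at `p` is bounded below by that affine function. -/
theorem ConvexOn.le_add_inner_of_le_add_sq {D : Set H} {k : H → ℝ} (hk : ConvexOn ℝ D k)
    {p s : H} {c : ℝ} (hp : p ∈ D) (hmin : ∀ v ∈ D, k p ≤ k v + ⟪s, v - p⟫ + c * ‖v - p‖ ^ 2)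
    {v : H} (hv : v ∈ D) : k p ≤ k v + ⟪s, v - p⟫ := by
  by_contra! hlt
  set ε := k p - (k v + ⟪s, v - p⟫)
  have hε0 : 0 < ε := sub_pos.2 hlt
  set C := c * ‖v - p‖ ^ 2
  have hden : 0 < ε + |C| := by positivity
  set t := ε / (ε + |C|) with ht
  have ht0 : 0 < t := by positivity
  have ht1 : t ≤ 1 := (div_le_one hden).2 (by linarith [abs_nonneg C])
  have hconv := hk.2 hp hv (sub_nonneg.2 ht1) ht0.le (by ring)
  have hmem := hk.1 hp hv (sub_nonneg.2 ht1) ht0.le (by ring)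
  have hle := hmin _ hmem
  have hdiff : (1 - t) • p + t • v - p = t • (v - p) := by module
  rw [hdiff, inner_smul_right, norm_smul, Real.norm_eq_abs, mul_pow, sq_abs] at hle
  simp only [smul_eq_mul] at hconv
  have hmul : t * ε ≤ t * (t * C) := by nlinarith
  have hεC : ε ≤ t * C := le_of_mul_le_mul_left hmul ht0
  have hεt : ε = t * (ε + |C|) := by rw [ht, div_mul_cancel₀ _ hden.ne']
  nlinarith [le_abs_self C]

theorem HasGradientAt.hasDerivAt_comp_lineMap [CompleteSpace H] {l : H → ℝ} {x d s : H} {t : ℝ}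
    (hl : HasGradientAt l s (x + t • d)) :
    HasDerivAt (fun r : ℝ => l (x + r • d)) ⟪s, d⟫ t := by
  have hline : HasDerivAt (fun r : ℝ => x + r • d) d t := by
    simpa using ((hasDerivAt_id t).smul_const d).const_add x
  have := hl.hasFDerivAt.comp_hasDerivAt t hline
  rwa [InnerProductSpace.toDual_apply_apply] at this

theorem ConvexOn.add_inner_gradient_le [CompleteSpace H] {l : H → ℝ} {x s : H}
    (hconv : ConvexOn ℝ Set.univ l) (hl : HasGradientAt l s x) (y : H) :
    l x + ⟪s, y - x⟫ ≤ l y := by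
  have hline : ConvexOn ℝ Set.univ (fun r : ℝ => l (x + r • (y - x))) := by
    refine ⟨convex_univ, fun a _ b _ p q hp hq hpq => ?_⟩
    have hcomb : x + (p • a + q • b) • (y - x)
        = p • (x + a • (y - x)) + q • (x + b • (y - x)) := by
      have hx : x = (p + q) • x := by rw [hpq, one_smul]
      nth_rewrite 1 [hx]
      simp only [smul_eq_mul]
      module
    dsimp only
    rw [hcomb]
    exact hconv.2 (Set.mem_univ _) (Set.mem_univ _) hp hq hpq
  have hderiv : HasDerivAt (fun r : ℝ => l (x + r • (y - x))) ⟪s, y - x⟫ 0 :=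
    HasGradientAt.hasDerivAt_comp_lineMap (by simpa using hl)
  have := hline.le_slope_of_hasDerivAt (Set.mem_univ 0) (Set.mem_univ 1) one_pos hderiv
  simp [slope_def_field] at this
  linarith

/-- The descent lemma. -/
theorem le_add_inner_add_sq_of_lipschitz_gradient [CompleteSpace H] {l : H → ℝ} {l' : H → H}
    {M : ℝ} (hgrad : ∀ x, HasGradientAt l (l' x) x)
    (hsmooth : ∀ x y, ‖l' x - l' y‖ ≤ M * ‖x - y‖) (x y : H) :
    l y ≤ l x + ⟪l' x, y - x⟫ + M / 2 * ‖y - x‖ ^ 2 := by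
  set d := y - x with hd
  set ψ : ℝ → ℝ := fun r => l (x + r • d) - (r * ⟪l' x, d⟫ + r ^ 2 * (M / 2 * ‖d‖ ^ 2)) with hψ
  have hderiv : ∀ r, HasDerivAt ψ
      (⟪l' (x + r • d), d⟫ - (⟪l' x, d⟫ + 2 * r * (M / 2 * ‖d‖ ^ 2))) r := by
    intro r
    have hlin : HasDerivAt (fun r : ℝ => r * ⟪l' x, d⟫) ⟪l' x, d⟫ r := by
      simpa using (hasDerivAt_id r).mul_const ⟪l' x, d⟫
    have hquad : HasDerivAt (fun r : ℝ => r ^ 2 * (M / 2 * ‖d‖ ^ 2))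
        (2 * r * (M / 2 * ‖d‖ ^ 2)) r := by
      simpa using (hasDerivAt_pow 2 r).mul_const (M / 2 * ‖d‖ ^ 2)
    exact (hgrad _).hasDerivAt_comp_lineMap.sub (hlin.add hquad)
  have hanti : AntitoneOn ψ (Set.Icc 0 1) := by
    refine antitoneOn_of_deriv_nonpos (convex_Icc 0 1)
      (fun r _ => (hderiv r).continuousAt.continuousWithinAt)
      (fun r _ => (hderiv r).differentiableAt.differentiableWithinAt) fun r hr => ?_
    rw [interior_Icc] at hr
    rw [(hderiv r).deriv]
    have hcs : ⟪l' (x + r • d) - l' x, d⟫ ≤ M * (r * ‖d‖) * ‖d‖ := by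
      refine (real_inner_le_norm _ _).trans ?_
      gcongr
      refine (hsmooth _ _).trans_eq ?_
      rw [add_sub_cancel_left, norm_smul, Real.norm_eq_abs, abs_of_pos hr.1]
    rw [inner_sub_left] at hcs
    linarith
  have := hanti (Set.left_mem_Icc.2 zero_le_one) (Set.right_mem_Icc.2 zero_le_one) zero_le_one
  simp [hψ, hd] at this
  linarith

/-- `p` is a proximal point of `u` for the function equal to `k` on `D` and to `+∞` elsewhere. -/
def IsProxPoint (D : Set H) (k : H → ℝ) (γ : ℝ) (u p : H) : Prop :=
  p ∈ D ∧ ∀ v ∈ D, k p + ‖u - p‖ ^ 2 / (2 * γ) ≤ k v + ‖u - v‖ ^ 2 / (2 * γ)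

theorem IsProxPoint.mul_sub_le_inner {D : Set H} {k : H → ℝ} {γ : ℝ} {u p v : H}
    (hp : IsProxPoint D k γ u p) (hk : ConvexOn ℝ D k) (hγ : 0 < γ) (hv : v ∈ D) :
    γ * (k p - k v) ≤ ⟪u - p, p - v⟫ := by
  have hsub := hk.le_add_inner_of_le_add_sq (s := γ⁻¹ • (p - u)) (c := 1 / (2 * γ)) hp.1
    (fun z hz => by
      have hz' := hp.2 z hz
      have hexp : ‖u - z‖ ^ 2 = ‖u - p‖ ^ 2 + 2 * ⟪p - u, z - p⟫ + ‖z - p‖ ^ 2 := by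
        rw [show u - z = -((p - u) + (z - p)) by abel, norm_neg, norm_add_sq_real,
          norm_sub_rev p u]
      rw [hexp] at hz'
      rw [real_inner_smul_left]
      have : (‖u - p‖ ^ 2 + 2 * ⟪p - u, z - p⟫ + ‖z - p‖ ^ 2) / (2 * γ)
          = ‖u - p‖ ^ 2 / (2 * γ) + γ⁻¹ * ⟪p - u, z - p⟫ + 1 / (2 * γ) * ‖z - p‖ ^ 2 := by
        field_simp
      linarith) hv
  rw [real_inner_smul_left] at hsub
  have hneg : ⟪u - p, p - v⟫ = ⟪p - u, v - p⟫ := by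
    rw [← neg_sub p u, ← neg_sub v p, inner_neg_neg]
  rw [hneg]
  calc γ * (k p - k v) ≤ γ * (γ⁻¹ * ⟪p - u, v - p⟫) := by gcongr; linarith
    _ = ⟪p - u, v - p⟫ := by field_simp

theorem IsProxPoint.norm_sub_le {D : Set H} {k : H → ℝ} {γ : ℝ} {u u' p p' : H}
    (hp : IsProxPoint D k γ u p) (hp' : IsProxPoint D k γ u' p') (hk : ConvexOn ℝ D k)
    (hγ : 0 < γ) : ‖p - p'‖ ≤ ‖u - u'‖ := by
  have h₁ := hp.mul_sub_le_inner hk hγ hp'.1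
  have h₂ := hp'.mul_sub_le_inner hk hγ hp.1
  have hsum : ⟪u - p, p - p'⟫ + ⟪u' - p', p' - p⟫ = ⟪u - u', p - p'⟫ - ‖p - p'‖ ^ 2 := by
    rw [← neg_sub p p', inner_neg_right, ← sub_eq_add_neg, ← inner_sub_left,
      ← real_inner_self_eq_norm_sq, ← inner_sub_left]
    congr 1
    abel
  have hcs := real_inner_le_norm (u - u') (p - p')
  have hsq : ‖p - p'‖ * ‖p - p'‖ ≤ ‖u - u'‖ * ‖p - p'‖ := by nlinarith
  rcases (norm_nonneg (p - p')).eq_or_lt with h0 | h0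
  · rw [← h0]; positivity
  · exact le_of_mul_le_mul_right hsq h0

/-- A lower semicontinuous function with an affine minorant touching it has proximal points. -/
theorem LowerSemicontinuous.exists_isProxPoint [FiniteDimensional ℝ H] {h : H → EReal}
    (hclosed : LowerSemicontinuous h) (hnobot : ∀ v, h v ≠ ⊥) {γ : ℝ} (hγ : 0 < γ) {z s : H}
    (hz : h z ≠ ⊤) (hsub : ∀ v, h v ≠ ⊤ → (h z).toReal ≤ (h v).toReal + ⟪s, v - z⟫) (u : H) :
    ∃ p, IsProxPoint {v | h v ≠ ⊤} (fun v => (h v).toReal) γ u p := by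
  have hlsc : LowerSemicontinuous fun v => h v + ((‖u - v‖ ^ 2 / (2 * γ) : ℝ) : EReal) := by
    refine hclosed.add' (Continuous.lowerSemicontinuous ?_) fun v => ?_
    · exact continuous_coe_real_ereal.comp (by fun_prop)
    · exact EReal.continuousAt_add (Or.inr (EReal.coe_ne_bot _)) (Or.inr (EReal.coe_ne_top _))
  obtain ⟨p, hpR, hpmin⟩ := (hlsc.lowerSemicontinuousOn _).exists_isMinOn
    (Metric.nonempty_closedBall.2 (by positivity))
    (isCompact_closedBall z (2 * ‖u - z + γ • s‖))
  have hreal : ∀ v, h v ≠ ⊤ → h v + ((‖u - v‖ ^ 2 / (2 * γ) : ℝ) : EReal)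
      = (((h v).toReal + ‖u - v‖ ^ 2 / (2 * γ) : ℝ) : EReal) := fun v hv => by
    rw [EReal.coe_add, EReal.coe_toReal hv (hnobot v)]
  have hpz := hpmin (Metric.mem_closedBall_self (by positivity))
  have hp : h p ≠ ⊤ := fun htop => by
    simp only [Set.mem_ofPred_eq] at hpz
    rw [hreal z hz, htop, EReal.top_add_coe, top_le_iff] at hpz
    exact EReal.coe_ne_top _ hpz
  refine ⟨p, hp, fun v hv => ?_⟩
  by_cases hvR : v ∈ Metric.closedBall z (2 * ‖u - z + γ • s‖)
  · have hpv := hpmin hvR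
    simp only [Set.mem_ofPred_eq] at hpv
    rwa [hreal p hp, hreal v hv, EReal.coe_le_coe_iff] at hpv
  · simp only [Set.mem_ofPred_eq] at hpz
    rw [hreal p hp, hreal z hz, EReal.coe_le_coe_iff] at hpz
    refine hpz.trans ?_
    rw [Metric.mem_closedBall, dist_eq_norm, not_le] at hvR
    have hexp : ‖u - v‖ ^ 2 = ‖u - z‖ ^ 2 - 2 * ⟪u - z, v - z⟫ + ‖v - z‖ ^ 2 := by
      rw [show u - v = (u - z) - (v - z) by abel, norm_sub_sq_real]
    have hcs := real_inner_le_norm (u - z + γ • s) (v - z)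
    rw [inner_add_left, real_inner_smul_left] at hcs
    have hdiv : ‖u - z‖ ^ 2 / (2 * γ) ≤ ‖u - v‖ ^ 2 / (2 * γ) - ⟪s, v - z⟫ := by
      rw [div_le_iff₀ (by positivity), sub_mul, div_mul_cancel₀ _ (by positivity), hexp]
      nlinarith [norm_nonneg (v - z), norm_nonneg (u - z + γ • s)]
    linarith [hsub v hv]

/-- One-step inequality of the proximal stochastic gradient method, before taking expectations.
Here `q` is the proximal point reached with the exact gradient. -/
theorem IsProxPoint.two_mul_sub_le [CompleteSpace H] {D : Set H} {k l : H → ℝ} {l' : H → H}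
    {M γ : ℝ} {x g p q z : H} (hk : ConvexOn ℝ D k) (hM : 0 < M) (hγ0 : 0 < γ) (hγ : γ ≤ 1 / M)
    (hgrad : ∀ x, HasGradientAt l (l' x) x) (hconvl : ConvexOn ℝ Set.univ l)
    (hsmooth : ∀ x y, ‖l' x - l' y‖ ≤ M * ‖x - y‖) (hp : IsProxPoint D k γ (x - γ • g) p)
    (hq : IsProxPoint D k γ (x - γ • l' x) q) (hz : z ∈ D) :
    2 * γ * ((l p + k p) - (l z + k z)) ≤ ‖x - z‖ ^ 2 - ‖p - z‖ ^ 2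
      + 2 * γ * ⟪g - l' x, z - q - (2 * γ) • l' x⟫ + 2 * γ ^ 2 * ‖g‖ ^ 2 := by
  have hprox := hp.mul_sub_le_inner hk hγ0 hz
  have hdesc := le_add_inner_add_sq_of_lipschitz_gradient hgrad hsmooth x p
  have hconv := hconvl.add_inner_gradient_le (hgrad x) z
  have hnoise : ⟪g - l' x, q - p⟫ ≤ γ * ‖g - l' x‖ ^ 2 := by
    have hqp := hq.norm_sub_le hp hk hγ0
    rw [show x - γ • l' x - (x - γ • g) = γ • (g - l' x) by module, norm_smul, Real.norm_eq_abs,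
      abs_of_pos hγ0] at hqp
    calc ⟪g - l' x, q - p⟫ ≤ ‖g - l' x‖ * ‖q - p‖ := real_inner_le_norm _ _
      _ ≤ ‖g - l' x‖ * (γ * ‖g - l' x‖) := by gcongr
      _ = γ * ‖g - l' x‖ ^ 2 := by ring
  have hMγ : γ * M ≤ 1 := (le_div_iff₀ hM).1 hγ
  have hxp : ‖x - z‖ ^ 2 = ‖p - x‖ ^ 2 - 2 * ⟪p - x, p - z⟫ + ‖p - z‖ ^ 2 := by
    rw [show x - z = (p - z) - (p - x) by abel, norm_sub_sq_real,
      real_inner_comm]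
    ring
  have hproxexp : ⟪x - γ • g - p, p - z⟫ = -⟪p - x, p - z⟫ - γ * ⟪g, p - z⟫ := by
    rw [show x - γ • g - p = -(p - x) - γ • g by abel, inner_sub_left, inner_neg_left,
      real_inner_smul_left]
  have hsq : ‖g - l' x‖ ^ 2 = ‖g‖ ^ 2 - ‖l' x‖ ^ 2 - 2 * ⟪g - l' x, l' x⟫ := by
    rw [norm_sub_sq_real, inner_sub_left, real_inner_self_eq_norm_sq]
    ring
  have hgrads : ⟪l' x, p - x⟫ - ⟪l' x, z - x⟫ = ⟪l' x, p - z⟫ := by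
    rw [← inner_sub_right]
    congr 1
    abel
  have hsplit : ⟪g - l' x, z - q - (2 * γ) • l' x⟫
      = ⟪l' x, p - z⟫ - ⟪g, p - z⟫ - ⟪g - l' x, q - p⟫ - 2 * γ * ⟪g - l' x, l' x⟫ := by
    rw [inner_sub_right, real_inner_smul_right,
      show z - q = -(p - z) - (q - p) by abel, inner_sub_right, inner_neg_right,
      inner_sub_left g (l' x) (p - z)]
    ring
  have hstep : γ * (l p - l z) ≤ γ * ⟪l' x, p - z⟫ + 1 / 2 * ‖p - x‖ ^ 2 := by
    have h1 : l p - l z ≤ ⟪l' x, p - z⟫ + M / 2 * ‖p - x‖ ^ 2 := by linarith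
    have h2 := mul_le_mul_of_nonneg_left h1 hγ0.le
    nlinarith [sq_nonneg ‖p - x‖]
  rw [hsplit]
  rw [hproxexp] at hprox
  rw [hsq] at hnoise
  have h3 := mul_le_mul_of_nonneg_left hnoise hγ0.le
  nlinarith [mul_nonneg (sq_nonneg γ) (sq_nonneg ‖l' x‖)]

end Deterministic

theorem LipschitzWith.memLp_comp_of_memLp_sub {E Ω : Type*} [NormedAddCommGroup E]
    [MeasurableSpace Ω] {P : Measure Ω} [IsFiniteMeasure P] {F : E → E} {K : NNReal}
    (hF : LipschitzWith K F) {X : Ω → E} {z : E} {p : ENNReal}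
    (hXm : AEStronglyMeasurable X P) (hX : MemLp (fun ω => X ω - z) p P) :
    MemLp (fun ω => F (X ω)) p P := by
  have hsub : MemLp (fun ω => F (X ω) - F z) p P :=
    hX.of_le_mul ((hF.continuous.comp_aestronglyMeasurable hXm).sub aestronglyMeasurable_const)
      (Filter.Eventually.of_forall fun ω => hF.norm_sub_le (X ω) z)
  simpa [Pi.add_def] using hsub.add (memLp_const (F z))

section Probability

variable {H Ω : Type*} [NormedAddCommGroup H] [InnerProductSpace ℝ H]
  {m mΩ : MeasurableSpace Ω} {P : Measure Ω}

theorem MeasureTheory.MemLp.integrable_real_inner {X Y : Ω → H} (hX : MemLp X 2 P)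
    (hY : MemLp Y 2 P) : Integrable (fun ω => ⟪X ω, Y ω⟫) P :=
  (hX.norm.integrable_mul hY.norm).mono' (hX.1.inner hY.1)
    (Filter.Eventually.of_forall fun ω => norm_inner_le_norm (X ω) (Y ω))

/-- The error of a conditional expectation is orthogonal to every square-integrable variable
measurable with respect to the conditioning σ-algebra. -/
theorem integral_inner_sub_condExp_eq_zero [CompleteSpace H] [IsFiniteMeasure P]
    (hm : m ≤ mΩ) {X E Y : Ω → H} (hX : MemLp X 2 P)
    (hE : MemLp E 2 P) (hXE : P[X | m] =ᵐ[P] E) (hY : MemLp Y 2 P) (hYm : StronglyMeasurable[m] Y) :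
    ∫ ω, ⟪X ω - E ω, Y ω⟫ ∂P = 0 := by
  have hpull := condExp_bilin_of_stronglyMeasurable_right (innerSL ℝ) (f := X) hYm
    (hX.integrable_real_inner hY) (hX.integrable one_le_two)
  have hXY : ∫ ω, ⟪X ω, Y ω⟫ ∂P = ∫ ω, ⟪E ω, Y ω⟫ ∂P := by
    rw [← integral_condExp hm]
    refine integral_congr_ae ?_
    filter_upwards [hpull, hXE] with ω h₁ h₂
    rw [← h₂]
    exact h₁
  simp_rw [inner_sub_left]
  rw [integral_sub (hX.integrable_real_inner hY) (hE.integrable_real_inner hY), hXY, sub_self]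

/-- Expectation of the upper bound in `IsProxPoint.two_mul_sub_le`, for a gradient estimator that
is unbiased and quadratically bounded conditionally on the iterate `X`. -/
theorem integral_step_le [FiniteDimensional ℝ H] [MeasurableSpace H] [BorelSpace H]
    [IsProbabilityMeasure P] {l' F : H → H} {K L : NNReal} (hl' : LipschitzWith K l')
    (hF : LipschitzWith L F) {X X' G : Ω → H} {z : H} {a b γ : ℝ} (hXm : Measurable X)
    (hGm : Measurable G) (hG : Integrable (fun ω => ‖G ω‖ ^ 2) P)
    (hX : Integrable (fun ω => ‖X ω - z‖ ^ 2) P) (hX' : Integrable (fun ω => ‖X' ω - z‖ ^ 2) P)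
    (hunbiased : P[G | MeasurableSpace.comap X ‹MeasurableSpace H›] =ᵐ[P] fun ω => l' (X ω))
    (hnoise : P[(fun ω => ‖G ω‖ ^ 2) | MeasurableSpace.comap X ‹MeasurableSpace H›]
        ≤ᵐ[P] fun ω => a * ‖X ω - z‖ ^ 2 + b) :
    Integrable (fun ω => ‖X ω - z‖ ^ 2 - ‖X' ω - z‖ ^ 2 + 2 * γ * ⟪G ω - l' (X ω), F (X ω)⟫
        + 2 * γ ^ 2 * ‖G ω‖ ^ 2) P
      ∧ ∫ ω, (‖X ω - z‖ ^ 2 - ‖X' ω - z‖ ^ 2 + 2 * γ * ⟪G ω - l' (X ω), F (X ω)⟫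
          + 2 * γ ^ 2 * ‖G ω‖ ^ 2) ∂P
        ≤ ∫ ω, ‖X ω - z‖ ^ 2 ∂P - ∫ ω, ‖X' ω - z‖ ^ 2 ∂P
          + 2 * γ ^ 2 * (a * ∫ ω, ‖X ω - z‖ ^ 2 ∂P + b) := by
  have hXs := hXm.aestronglyMeasurable (μ := P)
  have hX2 : MemLp (fun ω => X ω - z) 2 P :=
    (memLp_two_iff_integrable_sq_norm (hXs.sub aestronglyMeasurable_const)).2 hX
  have hG2 : MemLp G 2 P := (memLp_two_iff_integrable_sq_norm hGm.aestronglyMeasurable).2 hG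
  have hE2 := hl'.memLp_comp_of_memLp_sub hXs hX2
  have hF2 := hF.memLp_comp_of_memLp_sub hXs hX2
  have horth := integral_inner_sub_condExp_eq_zero hXm.comap_le hG2 hE2 hunbiased hF2
    (hF.continuous.measurable.comp (comap_measurable X)).stronglyMeasurable
  have hinner : Integrable (fun ω => ⟪G ω - l' (X ω), F (X ω)⟫) P :=
    (hG2.sub hE2).integrable_real_inner hF2
  have hvar : ∫ ω, ‖G ω‖ ^ 2 ∂P ≤ a * ∫ ω, ‖X ω - z‖ ^ 2 ∂P + b := by
    have hbound := integral_mono_ae integrable_condExp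
      ((hX.const_mul a).add (integrable_const b)) hnoise
    rw [integral_condExp hXm.comap_le] at hbound
    refine hbound.trans_eq ?_
    simp only [Pi.add_apply]
    rw [integral_add (hX.const_mul a) (integrable_const b), integral_const_mul]
    simp
  have hdist : Integrable (fun ω => ‖X ω - z‖ ^ 2 - ‖X' ω - z‖ ^ 2) P := hX.sub hX'
  have hsum : Integrable (fun ω => ‖X ω - z‖ ^ 2 - ‖X' ω - z‖ ^ 2
      + 2 * γ * ⟪G ω - l' (X ω), F (X ω)⟫) P := hdist.add (hinner.const_mul _)
  refine ⟨hsum.add (hG.const_mul _), ?_⟩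
  rw [integral_add hsum (hG.const_mul _), integral_add hdist (hinner.const_mul _),
    integral_sub hX hX', integral_const_mul, integral_const_mul, horth]
  nlinarith [sq_nonneg γ]

end Probability

theorem Finset.sum_Icc_one_eq_sum_range_succ {A : Type*} [AddCommMonoid A] (u : ℕ → A) (n : ℕ) :
    ∑ t ∈ Finset.Icc 1 n, u t = ∑ t ∈ Finset.range n, u (t + 1) := by
  rw [Finset.range_eq_Ico, Finset.sum_Ico_add' u 0 n 1, zero_add]
  rfl

theorem sum_range_pow_add_two_mul_one_sub (θ : ℝ) (n : ℕ) :
    (∑ t ∈ Finset.range n, θ ^ (t + 2)) * (1 - θ) = θ ^ 2 * (1 - θ ^ n) := by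
  induction n with
  | zero => simp
  | succ n ih => rw [Finset.sum_range_succ, add_mul, ih]; ring

/-- Telescoping of the weighted one-step recursion. -/
theorem weighted_average_recursion_le {a b γ θ : ℝ} (ha : 0 < a) (hγ : 0 < γ)
    (hθ : θ = 1 / (1 + 2 * a * γ ^ 2)) {r : ℕ → ℝ} (hr : ∀ t, 0 ≤ r t) {T : ℕ} (hT : 0 < T) :
    ∑ t ∈ Finset.range T, θ ^ (t + 2) / (∑ t ∈ Finset.range T, θ ^ (t + 2)) / (2 * γ)
        * (r t - r (t + 1) + 2 * γ ^ 2 * (a * r t + b))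
      ≤ γ * (a * r 0 / (1 - θ ^ T) + b) := by
  have hden : 0 < 1 + 2 * a * γ ^ 2 := by positivity
  have hθ0 : 0 < θ := by rw [hθ]; positivity
  have hθmul : θ * (1 + 2 * a * γ ^ 2) = 1 := by rw [hθ, one_div, inv_mul_cancel₀ hden.ne']
  have hθ1 : θ < 1 := by nlinarith [mul_pos ha (pow_pos hγ 2)]
  have hθT : 0 < 1 - θ ^ T := sub_pos.2 (pow_lt_one₀ hθ0.le hθ1 hT.ne')
  have htel : ∀ n, ∑ t ∈ Finset.range n, θ ^ (t + 2)
        * (r t - r (t + 1) + 2 * γ ^ 2 * (a * r t + b))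
      = θ * r 0 - θ ^ (n + 1) * r n + 2 * γ ^ 2 * b * ∑ t ∈ Finset.range n, θ ^ (t + 2) := by
    intro n
    induction n with
    | zero => simp
    | succ n ih =>
      rw [Finset.sum_range_succ, ih, Finset.sum_range_succ]
      linear_combination θ ^ (n + 1) * r n * hθmul
  have hgeom := sum_range_pow_add_two_mul_one_sub θ T
  set S := ∑ t ∈ Finset.range T, θ ^ (t + 2)
  have hS0 : 0 < S := by
    have : 0 < S * (1 - θ) := by rw [hgeom]; positivity
    exact pos_of_mul_pos_left this (sub_pos.2 hθ1).le
  have hfactor : ∑ t ∈ Finset.range T, θ ^ (t + 2) / S / (2 * γ)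
        * (r t - r (t + 1) + 2 * γ ^ 2 * (a * r t + b))
      = (θ * r 0 - θ ^ (T + 1) * r T + 2 * γ ^ 2 * b * S) / (2 * γ * S) := by
    rw [← htel, Finset.sum_div]
    refine Finset.sum_congr rfl fun t _ => ?_
    field_simp
  rw [hfactor, div_le_iff₀ (by positivity)]
  have hrS : a * r 0 / (1 - θ ^ T) * (2 * γ ^ 2 * S) = θ * r 0 := by
    have hSθ : S * (2 * a * γ ^ 2) = θ * (1 - θ ^ T) := by
      have h1θ : 1 - θ = θ * (2 * a * γ ^ 2) := by linarith
      rw [h1θ] at hgeom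
      refine mul_left_cancel₀ hθ0.ne' ?_
      linear_combination hgeom
    rw [div_mul_eq_mul_div, div_eq_iff hθT.ne']
    linear_combination r 0 * hSθ
  have hrT : 0 ≤ θ ^ (T + 1) * r T := mul_nonneg (by positivity) (hr T)
  have hexp : γ * (a * r 0 / (1 - θ ^ T) + b) * (2 * γ * S)
      = a * r 0 / (1 - θ ^ T) * (2 * γ ^ 2 * S) + 2 * γ ^ 2 * b * S := by ring
  rw [hexp, hrS]
  linarith

/-- **Prox-SGD, convex case.**
If `l` is convex and `M`-smooth, `h` is proper closed convex, `wstar ∈ argmin (l + h)`,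
and Prox-SGD is run with constant stepsize `γ ∈ (0, 1/M]` and quadratically bounded
gradient estimators, then with `θ = 1/(1+2aγ²)` and the weighted average
`w̄ᵀ = (Σ_{t=1}^T θ^{t+1} wᵗ)/(Σ_{t=1}^T θ^{t+1})`,
`E[f(w̄ᵀ) − inf f] ≤ γ (a‖w⁰ − w*‖²/(1 − θᵀ) + b)`; moreover if `γ = 1/√(aT)` and
`T ≥ max (M²/a) 2` then `E[f(w̄ᵀ)] − inf f ≤ (1/√(aT)) (2a‖w⁰ − w*‖² + b)`. -/
theorem prox_sgd_convex
    {H : Type*} [NormedAddCommGroup H] [InnerProductSpace ℝ H]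
    [FiniteDimensional ℝ H] [MeasurableSpace H] [BorelSpace H]
    {Ω : Type*} [MeasurableSpace Ω] (P : Measure Ω) [IsProbabilityMeasure P]
    (l : H → ℝ) (l' : H → H) (h : H → EReal)
    (M a b γ θ fstar : ℝ) (T : ℕ) (wstar w0 : H)
    (w g : ℕ → Ω → H) (wbarT : Ω → H)
    (hM : 0 < M) (ha : 0 < a) (hb : 0 ≤ b) (hT : 0 < T)
    -- `l` is differentiable with gradient `l'`, convex, and `M`-smooth
    (hgrad : ∀ x, HasGradientAt l (l' x) x)
    (hconvl : ConvexOn ℝ Set.univ l)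
    (hsmooth : ∀ x y, ‖l' x - l' y‖ ≤ M * ‖x - y‖)
    -- `h` is proper, closed and convex
    (hproper : ∃ v, h v ≠ ⊤) (hnobot : ∀ v, h v ≠ ⊥)
    (hclosed : LowerSemicontinuous h)
    (hconvex : ∀ x y : H, ∀ t : ℝ, 0 ≤ t → t ≤ 1 →
      h (t • x + (1 - t) • y) ≤ (t : EReal) * h x + ((1 - t : ℝ) : EReal) * h y)
    -- `wstar ∈ argmin (l + h)`, and `fstar = inf f = l wstar + h wstar` is finite
    (hmin : ∀ v, (l wstar : EReal) + h wstar ≤ (l v : EReal) + h v)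
    (hfstar : (fstar : EReal) = (l wstar : EReal) + h wstar)
    -- stepsize
    (hγ0 : 0 < γ) (hγ : γ ≤ 1 / M)
    -- `θ = 1/(1 + 2aγ²)`
    (hθ : θ = 1 / (1 + 2 * a * γ ^ 2))
    -- deterministic initialization
    (hw0 : ∀ ω, w 0 ω = w0)
    -- Prox-SGD iterates: `w (t+1) = prox_{γ h} (w t - γ • g t)`
    (hiter : ∀ t ω, ∀ v : H,
      h (w (t + 1) ω) + ((‖w t ω - γ • g t ω - w (t + 1) ω‖ ^ 2 / (2 * γ) : ℝ) : EReal)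
        ≤ h v + ((‖w t ω - γ • g t ω - v‖ ^ 2 / (2 * γ) : ℝ) : EReal))
    -- the weighted average `w̄ᵀ = (Σ_{t=1}^T θ^{t+1} wᵗ)/(Σ_{t=1}^T θ^{t+1})`
    (hwbarT : ∀ ω, wbarT ω
      = (∑ t ∈ Finset.Icc 1 T, θ ^ (t + 1))⁻¹ • ∑ t ∈ Finset.Icc 1 T, θ ^ (t + 1) • w t ω)
    -- measurability and integrability
    (hwmeas : ∀ t, Measurable (w t))
    (hgmeas : ∀ t, Measurable (g t))
    (hgint : ∀ t, Integrable (g t) P)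
    (hgsqint : ∀ t, Integrable (fun ω => ‖g t ω‖ ^ 2) P)
    (hwsqint : ∀ t, Integrable (fun ω => ‖w t ω - wstar‖ ^ 2) P)
    -- conditionally on `w t`, `g t` is an unbiased estimator of `∇ l (w t)` ...
    (hunbiased : ∀ t, P[g t | MeasurableSpace.comap (w t) ‹MeasurableSpace H›]
        =ᵐ[P] fun ω => l' (w t ω))
    -- ... whose expected squared norm is quadratically bounded with parameters `(a, b, wstar)`
    (hnoise : ∀ t, P[(fun ω => ‖g t ω‖ ^ 2) | MeasurableSpace.comap (w t) ‹MeasurableSpace H›]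
        ≤ᵐ[P] fun ω => a * ‖w t ω - wstar‖ ^ 2 + b) :
    -- main bound:  E[f(w̄ᵀ) − inf f] ≤ γ (a‖w⁰ − w*‖²/(1 − θᵀ) + b)
    (∫⁻ ω, erealToENNReal ((l (wbarT ω) : EReal) + h (wbarT ω) - (fstar : EReal)) ∂P
      ≤ ENNReal.ofReal (γ * (a * ‖w0 - wstar‖ ^ 2 / (1 - θ ^ T) + b)))
    -- moreover, if `γ = 1/√(aT)` and `T ≥ max (M²/a) 2` then the `1/√(aT)` rate holds
    ∧ (γ = 1 / Real.sqrt (a * T) → max (M ^ 2 / a) 2 ≤ (T : ℝ) →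
        ∫⁻ ω, erealToENNReal ((l (wbarT ω) : EReal) + h (wbarT ω) - (fstar : EReal)) ∂P
          ≤ ENNReal.ofReal (1 / Real.sqrt (a * T) * (2 * a * ‖w0 - wstar‖ ^ 2 + b))) := by
  set D : Set H := {v | h v ≠ ⊤}
  set k : H → ℝ := fun v => (h v).toReal
  have hcoe : ∀ v ∈ D, h v = (k v : EReal) := fun v hv =>
    (EReal.coe_toReal hv (hnobot v)).symm
  have hk : ConvexOn ℝ D k := by
    have hcomb : ∀ x ∈ D, ∀ y ∈ D, ∀ p q : ℝ, 0 ≤ p → 0 ≤ q → p + q = 1 →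
        h (p • x + q • y) ≤ ((p * k x + q * k y : ℝ) : EReal) := by
      intro x hx y hy p q hp hq hpq
      obtain rfl : q = 1 - p := by linarith
      have := hconvex x y p hp (by linarith)
      rw [hcoe x hx, hcoe y hy] at this
      exact_mod_cast this
    have hmem : Convex ℝ D := fun x hx y hy p q hp hq hpq =>
      ne_top_of_le_ne_top (EReal.coe_ne_top _) (hcomb x hx y hy p q hp hq hpq)
    refine ⟨hmem, fun x hx y hy p q hp hq hpq => ?_⟩
    have := hcomb x hx y hy p q hp hq hpq
    rw [hcoe _ (hmem hx hy hp hq hpq)] at this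
    exact EReal.coe_le_coe_iff.1 this
  have hstar : wstar ∈ D := fun htop => by
    rw [htop, EReal.coe_add_top] at hfstar
    exact EReal.coe_ne_top _ hfstar
  have hfs : fstar = l wstar + k wstar := by
    rw [hcoe _ hstar] at hfstar
    exact_mod_cast hfstar
  have hfmin : ∀ v ∈ D, l wstar + k wstar ≤ l v + k v := fun v hv => by
    have := hmin v
    rw [hcoe _ hstar, hcoe _ hv] at this
    exact_mod_cast this
  have hsub : ∀ v ∈ D, k wstar ≤ k v + ⟪l' wstar, v - wstar⟫ := fun v hv =>
    hk.le_add_inner_of_le_add_sq (c := M / 2) hstar (fun u hu => by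
      linarith [hfmin u hu, le_add_inner_add_sq_of_lipschitz_gradient hgrad hsmooth wstar u]) hv
  choose q hq using hclosed.exists_isProxPoint hnobot hγ0 hstar hsub
  have hprox : ∀ t ω, IsProxPoint D k γ (w t ω - γ • g t ω) (w (t + 1) ω) := by
    intro t ω
    have hmem : w (t + 1) ω ∈ D := fun htop => by
      have := hiter t ω wstar
      rw [htop, EReal.top_add_coe, hcoe _ hstar, top_le_iff] at this
      exact EReal.coe_ne_top _ (by exact_mod_cast this)
    refine ⟨hmem, fun v hv => ?_⟩
    have := hiter t ω v
    rw [hcoe _ hmem, hcoe _ hv] at this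
    exact_mod_cast this
  have hl' : LipschitzWith M.toNNReal l' := LipschitzWith.of_dist_le_mul fun x y => by
    rw [dist_eq_norm, dist_eq_norm, Real.coe_toNNReal M hM.le]
    exact hsmooth x y
  have hqlip : LipschitzWith 1 q := LipschitzWith.of_dist_le_mul fun x y => by
    rw [dist_eq_norm, dist_eq_norm, NNReal.coe_one, one_mul]
    exact (hq x).norm_sub_le (hq y) hk hγ0
  obtain ⟨L, hF⟩ : ∃ L, LipschitzWith L
      fun x => wstar - q (x - γ • l' x) - (2 * γ) • l' x :=
    ⟨_, ((LipschitzWith.const wstar).sub (hqlip.comp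
      (LipschitzWith.id.sub ((lipschitzWith_smul γ).comp hl')))).sub
        ((lipschitzWith_smul (2 * γ)).comp hl')⟩
  have hstep := fun t => integral_step_le (γ := γ) hl' hF (hwmeas t) (hgmeas t) (hgsqint t)
    (hwsqint t) (hwsqint (t + 1)) (hunbiased t) (hnoise t)
  set R : ℕ → Ω → ℝ := fun t ω => ‖w t ω - wstar‖ ^ 2 - ‖w (t + 1) ω - wstar‖ ^ 2
    + 2 * γ * ⟪g t ω - l' (w t ω),
        wstar - q (w t ω - γ • l' (w t ω)) - (2 * γ) • l' (w t ω)⟫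
    + 2 * γ ^ 2 * ‖g t ω‖ ^ 2
  have hRle : ∀ t ω, l (w (t + 1) ω) + k (w (t + 1) ω) - fstar ≤ R t ω / (2 * γ) := by
    intro t ω
    rw [le_div_iff₀ (by positivity), mul_comm, hfs]
    exact (hprox t ω).two_mul_sub_le hk hM hγ0 hγ hgrad hconvl hsmooth (hq _) hstar
  have hθ0 : 0 < θ := by rw [hθ]; positivity
  set S := ∑ t ∈ Finset.range T, θ ^ (t + 2)
  have hS0 : 0 < S := Finset.sum_pos (fun t _ => pow_pos hθ0 _)
    (Finset.nonempty_range_iff.2 hT.ne')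
  have hc0 : ∀ t, 0 ≤ θ ^ (t + 2) / S := fun t => div_nonneg (pow_nonneg hθ0.le _) hS0.le
  have hc1 : ∑ t ∈ Finset.range T, θ ^ (t + 2) / S = 1 := by
    rw [← Finset.sum_div, div_self hS0.ne']
  have hbar : ∀ ω, wbarT ω = ∑ t ∈ Finset.range T, (θ ^ (t + 2) / S) • w (t + 1) ω := by
    intro ω
    rw [hwbarT, Finset.sum_Icc_one_eq_sum_range_succ, Finset.sum_Icc_one_eq_sum_range_succ,
      Finset.smul_sum]
    refine Finset.sum_congr rfl fun t _ => ?_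
    rw [smul_smul, div_eq_inv_mul]
  have hf : ConvexOn ℝ D (fun v => l v + k v) := (hconvl.subset (Set.subset_univ _) hk.1).add hk
  have hbarD : ∀ ω, wbarT ω ∈ D := fun ω => by
    rw [hbar]
    exact hk.1.sum_mem (fun t _ => hc0 t) hc1 fun t _ => (hprox t ω).1
  set Y : Ω → ℝ := fun ω => ∑ t ∈ Finset.range T, θ ^ (t + 2) / S / (2 * γ) * R t ω with hY
  have hYle : ∀ ω, l (wbarT ω) + k (wbarT ω) - fstar ≤ Y ω := by
    intro ω
    have hjensen := hf.map_sum_le (fun t _ => hc0 t) hc1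
      (fun t (_ : t ∈ Finset.range T) => (hprox t ω).1)
    rw [← hbar] at hjensen
    calc l (wbarT ω) + k (wbarT ω) - fstar
        ≤ ∑ t ∈ Finset.range T, (θ ^ (t + 2) / S) • (l (w (t + 1) ω) + k (w (t + 1) ω))
          - (∑ t ∈ Finset.range T, θ ^ (t + 2) / S) * fstar := by
          rw [hc1, one_mul]
          exact sub_le_sub_right hjensen _
      _ = ∑ t ∈ Finset.range T, θ ^ (t + 2) / S * (l (w (t + 1) ω) + k (w (t + 1) ω) - fstar) := by
          rw [Finset.sum_mul, ← Finset.sum_sub_distrib]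
          exact Finset.sum_congr rfl fun t _ => by rw [smul_eq_mul, mul_sub]
      _ ≤ Y ω := Finset.sum_le_sum fun t _ => by
          rw [div_mul_eq_mul_div (θ ^ (t + 2) / S), mul_div_assoc]
          exact mul_le_mul_of_nonneg_left (hRle t ω) (hc0 t)
  have hYint : Integrable Y P := integrable_finsetSum _ fun t _ => (hstep t).1.const_mul _
  have hY0 : ∀ ω, 0 ≤ Y ω := fun ω =>
    le_trans (by rw [hfs]; exact sub_nonneg.2 (hfmin _ (hbarD ω))) (hYle ω)
  have hEY : ∫ ω, Y ω ∂P ≤ γ * (a * ‖w0 - wstar‖ ^ 2 / (1 - θ ^ T) + b) := by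
    have hrec := weighted_average_recursion_le (b := b) ha hγ0 hθ
      (r := fun t => ∫ ω, ‖w t ω - wstar‖ ^ 2 ∂P) (fun t => integral_nonneg fun ω => by positivity)
      hT
    have hr0 : ∫ ω, ‖w 0 ω - wstar‖ ^ 2 ∂P = ‖w0 - wstar‖ ^ 2 := by simp [hw0]
    rw [hr0] at hrec
    refine le_trans ?_ hrec
    rw [integral_finsetSum _ fun t _ => (hstep t).1.const_mul _]
    refine Finset.sum_le_sum fun t _ => ?_
    rw [integral_const_mul]
    exact mul_le_mul_of_nonneg_left (hstep t).2 (div_nonneg (hc0 t) (by positivity))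
  have hmain : ∫⁻ ω, erealToENNReal ((l (wbarT ω) : EReal) + h (wbarT ω) - (fstar : EReal)) ∂P
      ≤ ENNReal.ofReal (γ * (a * ‖w0 - wstar‖ ^ 2 / (1 - θ ^ T) + b)) := by
    refine le_trans ?_ (ENNReal.ofReal_le_ofReal hEY)
    rw [ofReal_integral_eq_lintegral_ofReal hYint (Filter.Eventually.of_forall hY0)]
    refine lintegral_mono fun ω => ?_
    rw [hcoe _ (hbarD ω), ← EReal.coe_add, ← EReal.coe_sub, erealToENNReal,
      if_neg (EReal.coe_ne_top _), EReal.toReal_coe]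
    exact ENNReal.ofReal_le_ofReal (hYle ω)
  refine ⟨hmain, fun hγT _ => hmain.trans (ENNReal.ofReal_le_ofReal ?_)⟩
  have hT' : (0 : ℝ) < T := Nat.cast_pos.2 hT
  rw [← hγT]
  have hθT : θ ^ T ≤ 1 / 2 := by
    have hγsq : 2 * a * γ ^ 2 = 2 / T := by
      rw [hγT, div_pow, one_pow, Real.sq_sqrt (by positivity)]
      field_simp
    have hbern := one_add_mul_le_pow (a := 2 / (T : ℝ)) (by linarith [div_pos two_pos hT']) T
    rw [mul_div_cancel₀ _ hT'.ne'] at hbern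
    rw [hθ, hγsq, div_pow, one_pow]
    exact one_div_le_one_div_of_le two_pos (by linarith)
  gcongr
  rw [div_le_iff₀ (by linarith)]
  nlinarith [mul_nonneg ha.le (sq_nonneg ‖w0 - wstar‖)]
end

section
/- Let H be a real finite-dimensional inner product space, let W ⊆ H be a nonempty closed convex set, let f : H → ℝ be convex and differentiable on W, and let w* ∈ argmin_W f. Let (w^t) be generated by Proj-SGD with constant stepsize γ > 0, where conditionally on w^t the estimator g^t is a quadratically bounded estimator for ∇f at w^t with parameters (a, b, w*). Define θ = 1/(1 + aγ²) and w̄^T = (Σ_{t=0}^{T−1} θ^{t+1} w^t)/(Σ_{t=0}^{T−1} θ^{t+1}). Then E[f(w̄^T) − inf_W f] ≤ (γ/2)(a‖w⁰ − w*‖²/(1 − θ^T) + b). Moreover, if γ = √(2/(aT)) and T ≥ 2, then E[f(w̄^T)] − inf_W f ≤ (√(2a)/√T)‖w⁰ − w*‖² + b/√(2aT). -/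
open MeasureTheory

section Convex

variable {H : Type*} [NormedAddCommGroup H] [InnerProductSpace ℝ H]

/-- A convex function lies above its tangent hyperplanes. -/
lemma ConvexOn.add_inner_le_of_hasGradientAt [CompleteSpace H] {f : H → ℝ} {f' x : H}
    (hf : ConvexOn ℝ Set.univ f) (hx : HasGradientAt f f' x) (y : H) :
    f x + inner ℝ f' (y - x) ≤ f y := by
  have hline : ConvexOn ℝ Set.univ (fun t : ℝ => f (AffineMap.lineMap x y t)) := by
    simpa [Function.comp_def] using hf.comp_affineMap (AffineMap.lineMap x y : ℝ →ᵃ[ℝ] H)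
  have hderiv : HasDerivAt (fun t : ℝ => f (AffineMap.lineMap x y t)) (inner ℝ f' (y - x)) 0 := by
    have hfx : HasFDerivAt f (InnerProductSpace.toDual ℝ H f')
        (AffineMap.lineMap x y (0 : ℝ)) := by
      simpa using hx.hasFDerivAt
    simpa [Function.comp_def] using hfx.comp_hasDerivAt (0 : ℝ) AffineMap.hasDerivAt_lineMap
  have := hline.le_slope_of_hasDerivAt (Set.mem_univ 0) (Set.mem_univ 1) one_pos hderiv
  simp [slope_def_field] at this
  linarith

/-- The nearest point `p` of a convex set to `x` is at least as close as `x` to every point of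
the set. -/
lemma Convex.norm_sub_le_of_forall_norm_sub_le {W : Set H} (hW : Convex ℝ W) {x p z : H}
    (hp : p ∈ W) (hmin : ∀ v ∈ W, ‖p - x‖ ≤ ‖v - x‖) (hz : z ∈ W) :
    ‖p - z‖ ≤ ‖x - z‖ := by
  have : Nonempty W := ⟨⟨p, hp⟩⟩
  have hinf : ‖x - p‖ = ⨅ v : W, ‖x - v‖ := by
    refine le_antisymm (le_ciInf fun v => ?_) ?_
    · simpa only [norm_sub_rev x] using hmin v v.2
    · exact ciInf_le ⟨0, Set.forall_mem_range.2 fun v => norm_nonneg _⟩ (⟨p, hp⟩ : W)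
  have hinner := (norm_eq_iInf_iff_real_inner_le_zero hW hp).1 hinf z hz
  have hexp := norm_sub_sq_real (x - p) (z - p)
  rw [sub_sub_sub_cancel_right, norm_sub_rev z p] at hexp
  exact le_of_sq_le_sq (by nlinarith [sq_nonneg ‖x - p‖]) (norm_nonneg _)

end Convex

section CondExp

variable {H Ω : Type*} [NormedAddCommGroup H] [InnerProductSpace ℝ H]
  {m m₀ : MeasurableSpace Ω} {P : Measure Ω} {X Y Z : Ω → H}

/-- The inner product of two square-integrable functions is integrable. -/
lemma MeasureTheory.MemLp.integrable_inner_of_two (hX : MemLp X 2 P) (hY : MemLp Y 2 P) :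
    Integrable (fun ω => inner ℝ (X ω) (Y ω)) P :=
  (hX.norm.integrable_mul hY.norm).mono' (hX.1.inner hY.1)
    (.of_forall fun _ => norm_inner_le_norm _ _)

/-- A measurable factor can be pulled out of the conditional expectation of an inner product. -/
lemma condExp_inner_of_memLp_two [CompleteSpace H] [IsFiniteMeasure P]
    (hXm : StronglyMeasurable[m] X) (hX : MemLp X 2 P) (hY : MemLp Y 2 P) (hZ : P[Y | m] =ᵐ[P] Z) :
    P[fun ω => inner ℝ (X ω) (Y ω) | m] =ᵐ[P] fun ω => inner ℝ (X ω) (Z ω) := by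
  have h := condExp_bilin_of_stronglyMeasurable_left (innerSL ℝ) hXm (hX.integrable_inner_of_two hY)
    (hY.integrable one_le_two)
  filter_upwards [h, hZ] with ω h₁ h₂
  rw [← h₂]
  exact h₁

end CondExp

section Step

variable {H : Type*} [NormedAddCommGroup H] [InnerProductSpace ℝ H]
  [FiniteDimensional ℝ H] [MeasurableSpace H] [BorelSpace H]
  {Ω : Type*} [MeasurableSpace Ω] {P : Measure Ω} [IsProbabilityMeasure P]
  {f : H → ℝ} {f' : H → H} {a b γ : ℝ} {z : H} {X G Y : Ω → H}

/-- The suboptimality gap at `X` is integrable, and its expectation is controlled by the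
correlation of `X - z` with any square-integrable unbiased gradient estimator `G`. -/
lemma integrable_sub_and_integral_sub_le_integral_inner
    (hf : ConvexOn ℝ Set.univ f) (hgrad : ∀ ω, HasGradientAt f (f' (X ω)) (X ω))
    (hmin : ∀ ω, f z ≤ f (X ω)) (hXm : Measurable X)
    (hX : MemLp (fun ω => X ω - z) 2 P) (hG : MemLp G 2 P)
    (hunb : P[G | MeasurableSpace.comap X ‹_›] =ᵐ[P] fun ω => f' (X ω)) :
    Integrable (fun ω => f (X ω) - f z) P ∧
      ∫ ω, (f (X ω) - f z) ∂P ≤ ∫ ω, inner ℝ (X ω - z) (G ω) ∂P := by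
  have hXm' : StronglyMeasurable[MeasurableSpace.comap X ‹_›] fun ω => X ω - z :=
    ((comap_measurable X).sub_const z).stronglyMeasurable
  have hce := condExp_inner_of_memLp_two hXm' hX hG hunb
  have hint : Integrable (fun ω => inner ℝ (X ω - z) (f' (X ω))) P := integrable_condExp.congr hce
  have hle (ω : Ω) : f (X ω) - f z ≤ inner ℝ (X ω - z) (f' (X ω)) := by
    have := hf.add_inner_le_of_hasGradientAt (hgrad ω) z
    rw [← neg_sub (X ω) z, inner_neg_right, real_inner_comm] at this
    linarith
  have hgap : Integrable (fun ω => f (X ω) - f z) P := by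
    refine hint.mono' ?_ (.of_forall fun ω => ?_)
    · exact ((hf.locallyLipschitz.continuous.measurable.comp hXm).sub_const _).aestronglyMeasurable
    · rw [Real.norm_of_nonneg (sub_nonneg.2 (hmin ω))]
      exact hle ω
  refine ⟨hgap, (integral_mono hgap hint hle).trans_eq ?_⟩
  rw [← integral_congr_ae hce, integral_condExp hXm.comap_le]

/-- One step of projected stochastic gradient descent, in expectation. -/
lemma integral_norm_sq_le_of_proj_step
    (hle : ∀ ω, ‖Y ω - z‖ ≤ ‖X ω - γ • G ω - z‖) (hγ : 0 ≤ γ)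
    (hf : ConvexOn ℝ Set.univ f) (hgrad : ∀ ω, HasGradientAt f (f' (X ω)) (X ω))
    (hmin : ∀ ω, f z ≤ f (X ω)) (hXm : Measurable X)
    (hX : MemLp (fun ω => X ω - z) 2 P) (hG : MemLp G 2 P) (hY : MemLp (fun ω => Y ω - z) 2 P)
    (hunb : P[G | MeasurableSpace.comap X ‹_›] =ᵐ[P] fun ω => f' (X ω))
    (hnoise : P[(fun ω => ‖G ω‖ ^ 2) | MeasurableSpace.comap X ‹_›]
      ≤ᵐ[P] fun ω => a * ‖X ω - z‖ ^ 2 + b) :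
    ∫ ω, ‖Y ω - z‖ ^ 2 ∂P ≤ (1 + a * γ ^ 2) * ∫ ω, ‖X ω - z‖ ^ 2 ∂P
      - 2 * γ * ∫ ω, (f (X ω) - f z) ∂P + γ ^ 2 * b := by
  have hXX := hX.integrable_norm_pow two_ne_zero
  have hGG := hG.integrable_norm_pow two_ne_zero
  have hYY := hY.integrable_norm_pow two_ne_zero
  have hXG : Integrable (fun ω => inner ℝ (X ω - z) (G ω)) P := hX.integrable_inner_of_two hG
  have hgap := (integrable_sub_and_integral_sub_le_integral_inner hf hgrad hmin hXm hX hG hunb).2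
  have hvar : ∫ ω, ‖G ω‖ ^ 2 ∂P ≤ a * ∫ ω, ‖X ω - z‖ ^ 2 ∂P + b := by
    calc ∫ ω, ‖G ω‖ ^ 2 ∂P
        = ∫ ω, (P[(fun ω => ‖G ω‖ ^ 2) | MeasurableSpace.comap X ‹_›]) ω ∂P :=
          (integral_condExp hXm.comap_le).symm
      _ ≤ ∫ ω, (a * ‖X ω - z‖ ^ 2 + b) ∂P :=
          integral_mono_ae integrable_condExp ((hXX.const_mul a).add (integrable_const b)) hnoise
      _ = a * ∫ ω, ‖X ω - z‖ ^ 2 ∂P + b := by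
          rw [integral_add (hXX.const_mul a) (integrable_const b), integral_const_mul]
          simp
  have hexp : ∫ ω, ‖Y ω - z‖ ^ 2 ∂P ≤
      ∫ ω, (‖X ω - z‖ ^ 2 - 2 * γ * inner ℝ (X ω - z) (G ω) + γ ^ 2 * ‖G ω‖ ^ 2) ∂P := by
    refine integral_mono hYY ((hXX.sub (hXG.const_mul _)).add (hGG.const_mul _)) fun ω => ?_
    calc ‖Y ω - z‖ ^ 2 ≤ ‖(X ω - z) - γ • G ω‖ ^ 2 := by
          rw [sub_right_comm]
          exact pow_le_pow_left₀ (norm_nonneg _) (hle ω) 2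
      _ = _ := by
          rw [norm_sub_sq_real, real_inner_smul_right, norm_smul, mul_pow, Real.norm_eq_abs, sq_abs]
          ring
  have hsplit : ∫ ω, (‖X ω - z‖ ^ 2 - 2 * γ * inner ℝ (X ω - z) (G ω) + γ ^ 2 * ‖G ω‖ ^ 2) ∂P =
      ∫ ω, ‖X ω - z‖ ^ 2 ∂P - 2 * γ * ∫ ω, inner ℝ (X ω - z) (G ω) ∂P
        + γ ^ 2 * ∫ ω, ‖G ω‖ ^ 2 ∂P := by
    rw [← integral_const_mul, ← integral_const_mul, ← integral_sub hXX (hXG.const_mul _)]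
    exact integral_add (hXX.sub (hXG.const_mul _)) (hGG.const_mul _)
  rw [hsplit] at hexp
  nlinarith [mul_le_mul_of_nonneg_left hgap (mul_nonneg zero_le_two hγ),
    mul_le_mul_of_nonneg_left hvar (sq_nonneg γ)]

end Step

/-- Weighted telescoping of the recursion `r (t + 1) ≤ θ⁻¹ r t - 2 γ δ t + γ² b`. -/
lemma sum_pow_mul_le_of_le_sub {a b γ θ : ℝ} {r δ : ℕ → ℝ} (hθ : 0 < θ)
    (hθ' : θ * (1 + a * γ ^ 2) = 1) (hr : ∀ t, 0 ≤ r t)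
    (h : ∀ t, r (t + 1) ≤ (1 + a * γ ^ 2) * r t - 2 * γ * δ t + γ ^ 2 * b) (T : ℕ) :
    2 * γ * ∑ t ∈ Finset.range T, θ ^ (t + 1) * δ t
      ≤ r 0 + γ ^ 2 * b * ∑ t ∈ Finset.range T, θ ^ (t + 1) := by
  suffices H : 2 * γ * ∑ t ∈ Finset.range T, θ ^ (t + 1) * δ t + θ ^ T * r T
      ≤ r 0 + γ ^ 2 * b * ∑ t ∈ Finset.range T, θ ^ (t + 1) by
    linarith [mul_nonneg (pow_pos hθ T).le (hr T)]
  induction T with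
  | zero => simp
  | succ T ih =>
    rw [Finset.sum_range_succ, Finset.sum_range_succ]
    have hstep := mul_le_mul_of_nonneg_left (h T) (pow_pos hθ (T + 1)).le
    have hpow : θ ^ (T + 1) * ((1 + a * γ ^ 2) * r T) = θ ^ T * r T := by
      linear_combination θ ^ T * r T * hθ'
    linarith

/-- **Proj-SGD, convex case.**
If `W` is nonempty closed convex, `f` is convex and differentiable on `W`,
`wstar ∈ argmin_W f`, and Proj-SGD is run with constant stepsize `γ > 0` with
quadratically bounded gradient estimators, then with `θ = 1/(1+aγ²)` and the weighted
average `w̄ᵀ = (Σ_{t=0}^{T−1} θ^{t+1} wᵗ)/(Σ_{t=0}^{T−1} θ^{t+1})`,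
`E[f(w̄ᵀ) − inf_W f] ≤ (γ/2)(a‖w⁰ − w*‖²/(1 − θᵀ) + b)`; moreover if `γ = √(2/(aT))`
and `T ≥ 2` then `E[f(w̄ᵀ)] − inf_W f ≤ (√(2a)/√T)‖w⁰ − w*‖² + b/√(2aT)`. -/
theorem proj_sgd_convex
    {H : Type*} [NormedAddCommGroup H] [InnerProductSpace ℝ H]
    [FiniteDimensional ℝ H] [MeasurableSpace H] [BorelSpace H]
    {Ω : Type*} [MeasurableSpace Ω] (P : Measure Ω) [IsProbabilityMeasure P]
    (W : Set H) (f : H → ℝ) (f' : H → H)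
    (a b γ θ : ℝ) (T : ℕ) (wstar w0 : H)
    (w g : ℕ → Ω → H) (wbarT : Ω → H)
    (ha : 0 < a) (hb : 0 ≤ b) (hT : 0 < T)
    -- `W` is a nonempty closed convex set
    (hWne : W.Nonempty) (hWclosed : IsClosed W) (hWconvex : Convex ℝ W)
    -- `f` is convex
    (hconvf : ConvexOn ℝ Set.univ f)
    -- `f` is differentiable on `W` with gradient `f'`
    (hgrad : ∀ x ∈ W, HasGradientAt f (f' x) x)
    -- `wstar ∈ argmin_W f`
    (hstarW : wstar ∈ W) (hmin : ∀ v ∈ W, f wstar ≤ f v)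
    -- stepsize
    (hγ0 : 0 < γ)
    -- `θ = 1/(1 + aγ²)`
    (hθ : θ = 1 / (1 + a * γ ^ 2))
    -- deterministic initialization in `W`
    (hw0 : ∀ ω, w 0 ω = w0) (hw0W : w0 ∈ W)
    -- Proj-SGD iterates: `w (t+1) = proj_W (w t - γ • g t)`
    (hiterW : ∀ t ω, w (t + 1) ω ∈ W)
    (hiter : ∀ t ω, ∀ v ∈ W,
      ‖w (t + 1) ω - (w t ω - γ • g t ω)‖ ≤ ‖v - (w t ω - γ • g t ω)‖)
    -- the weighted average `w̄ᵀ = (Σ_{t=0}^{T−1} θ^{t+1} wᵗ)/(Σ_{t=0}^{T−1} θ^{t+1})`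
    (hwbarT : ∀ ω, wbarT ω
      = (∑ t ∈ Finset.range T, θ ^ (t + 1))⁻¹ • ∑ t ∈ Finset.range T, θ ^ (t + 1) • w t ω)
    -- measurability and integrability
    (hwmeas : ∀ t, Measurable (w t))
    (hgmeas : ∀ t, Measurable (g t))
    (hgint : ∀ t, Integrable (g t) P)
    (hgsqint : ∀ t, Integrable (fun ω => ‖g t ω‖ ^ 2) P)
    (hwsqint : ∀ t, Integrable (fun ω => ‖w t ω - wstar‖ ^ 2) P)
    (hfint : Integrable (fun ω => f (wbarT ω)) P)
    -- conditionally on `w t`, `g t` is an unbiased estimator of `∇ f (w t)` ...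
    (hunbiased : ∀ t, P[g t | MeasurableSpace.comap (w t) ‹MeasurableSpace H›]
        =ᵐ[P] fun ω => f' (w t ω))
    -- ... whose expected squared norm is quadratically bounded with parameters `(a, b, wstar)`
    (hnoise : ∀ t, P[(fun ω => ‖g t ω‖ ^ 2) | MeasurableSpace.comap (w t) ‹MeasurableSpace H›]
        ≤ᵐ[P] fun ω => a * ‖w t ω - wstar‖ ^ 2 + b) :
    -- main bound: `E[f(w̄ᵀ) − inf_W f] ≤ (γ/2)(a‖w⁰ − w*‖²/(1 − θᵀ) + b)`
    (∫ ω, (f (wbarT ω) - f wstar) ∂P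
      ≤ γ / 2 * (a * ‖w0 - wstar‖ ^ 2 / (1 - θ ^ T) + b))
    -- moreover, if `γ = √(2/(aT))` and `T ≥ 2`, the `1/√T` rate holds
    ∧ (γ = Real.sqrt (2 / (a * T)) → 2 ≤ T →
        ∫ ω, (f (wbarT ω) - f wstar) ∂P
          ≤ Real.sqrt (2 * a) / Real.sqrt T * ‖w0 - wstar‖ ^ 2
            + b / Real.sqrt (2 * a * T)) := by
  have hX (t : ℕ) : MemLp (fun ω => w t ω - wstar) 2 P :=
    (memLp_two_iff_integrable_sq_norm ((hwmeas t).sub_const _).aestronglyMeasurable).2 (hwsqint t)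
  have hG (t : ℕ) : MemLp (g t) 2 P :=
    (memLp_two_iff_integrable_sq_norm (hgmeas t).aestronglyMeasurable).2 (hgsqint t)
  have hwW (t : ℕ) (ω : Ω) : w t ω ∈ W := by
    cases t with
    | zero => exact hw0 ω ▸ hw0W
    | succ t => exact hiterW t ω
  have hgap (t : ℕ) : Integrable (fun ω => f (w t ω) - f wstar) P :=
    (integrable_sub_and_integral_sub_le_integral_inner hconvf (fun ω => hgrad _ (hwW t ω))
      (fun ω => hmin _ (hwW t ω)) (hwmeas t) (hX t) (hG t) (hunbiased t)).1
  have hden : 0 < 1 + a * γ ^ 2 := by positivity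
  have hθ0 : 0 < θ := hθ ▸ by positivity
  have hθ' : θ * (1 + a * γ ^ 2) = 1 := by rw [hθ]; field_simp
  have hθ1 : θ < 1 := by nlinarith [mul_pos hθ0 (mul_pos ha (pow_pos hγ0 2))]
  have hTpow : 0 < 1 - θ ^ T := sub_pos.2 (pow_lt_one₀ hθ0.le hθ1 hT.ne')
  set S : ℝ := ∑ t ∈ Finset.range T, θ ^ (t + 1) with hS
  have hSpos : 0 < S :=
    Finset.sum_pos (fun t _ => pow_pos hθ0 _) (Finset.nonempty_range_iff.2 hT.ne')
  have hSeq : a * γ ^ 2 * S = 1 - θ ^ T := by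
    have hgeom := mul_neg_geom_sum θ T
    have hSfac : S = θ * ∑ t ∈ Finset.range T, θ ^ t := by
      rw [hS, Finset.mul_sum]
      exact Finset.sum_congr rfl fun t _ => pow_succ' θ t
    rw [hSfac]
    linear_combination hgeom + (∑ t ∈ Finset.range T, θ ^ t) * hθ'
  have hsum := sum_pow_mul_le_of_le_sub (r := fun t => ∫ ω, ‖w t ω - wstar‖ ^ 2 ∂P)
    (δ := fun t => ∫ ω, (f (w t ω) - f wstar) ∂P) hθ0 hθ'
    (fun t => integral_nonneg fun ω => sq_nonneg _)
    (fun t => integral_norm_sq_le_of_proj_step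
      (fun ω => hWconvex.norm_sub_le_of_forall_norm_sub_le (hiterW t ω) (hiter t ω) hstarW)
      hγ0.le hconvf (fun ω => hgrad _ (hwW t ω)) (fun ω => hmin _ (hwW t ω)) (hwmeas t)
      (hX t) (hG t) (hX (t + 1)) (hunbiased t) (hnoise t)) T
  simp only [hw0, integral_const, probReal_univ, one_smul] at hsum
  have hjensen : ∫ ω, (f (wbarT ω) - f wstar) ∂P
      ≤ S⁻¹ * ∑ t ∈ Finset.range T, θ ^ (t + 1) * ∫ ω, (f (w t ω) - f wstar) ∂P := by
    have hint (t : ℕ) (_ : t ∈ Finset.range T) :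
        Integrable (fun ω => θ ^ (t + 1) * (f (w t ω) - f wstar)) P := (hgap t).const_mul _
    simp_rw [← integral_const_mul]
    rw [← integral_finsetSum _ hint, ← integral_const_mul]
    refine integral_mono (hfint.sub (integrable_const _))
      ((integrable_finsetSum _ hint).const_mul _) fun ω => ?_
    have hcm := hconvf.map_centerMass_le (t := Finset.range T) (w := fun t => θ ^ (t + 1))
      (p := fun t => w t ω) (fun t _ => (pow_pos hθ0 _).le) hSpos (fun t _ => Set.mem_univ _)
    simp only [Finset.centerMass, ← hS, ← hwbarT, smul_eq_mul, Function.comp_apply] at hcm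
    simp only [mul_sub, Finset.sum_sub_distrib, ← Finset.sum_mul, ← hS]
    rw [inv_mul_cancel_left₀ hSpos.ne']
    exact sub_le_sub_right hcm _
  have hmain : ∫ ω, (f (wbarT ω) - f wstar) ∂P
      ≤ γ / 2 * (a * ‖w0 - wstar‖ ^ 2 / (1 - θ ^ T) + b) := by
    refine hjensen.trans ?_
    rw [inv_mul_le_iff₀ hSpos, ← hSeq]
    have hrhs : S * (γ / 2 * (a * ‖w0 - wstar‖ ^ 2 / (a * γ ^ 2 * S) + b))
        = (‖w0 - wstar‖ ^ 2 + γ ^ 2 * b * S) / (2 * γ) := by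
      field_simp
    rw [hrhs, le_div_iff₀ (by positivity)]
    linarith
  refine ⟨hmain, fun hγ _ => hmain.trans ?_⟩
  have hT0 : (0 : ℝ) < T := Nat.cast_pos.2 hT
  have hγsq : a * γ ^ 2 * T = 2 := by
    rw [hγ, Real.sq_sqrt (by positivity)]
    field_simp
  have hhalf : θ ^ T ≤ 1 / 2 := by
    have hbern := one_add_mul_le_pow (a := a * γ ^ 2) (by nlinarith [sq_nonneg γ]) T
    rw [hθ, one_div_pow]
    exact one_div_le_one_div_of_le two_pos (by linarith)
  have hγa : γ * a = √(2 * a) / √T := by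
    rw [← Real.sqrt_div (by positivity)]
    refine ((Real.sqrt_eq_iff_eq_sq (by positivity) (by positivity)).2 ?_).symm
    field_simp
    linear_combination -hγsq
  have hγb : γ / 2 = 1 / √(2 * a * T) := by
    have : √(2 * a * T) = 2 / γ := by
      refine (Real.sqrt_eq_iff_eq_sq (by positivity) (by positivity)).2 ?_
      field_simp
      linear_combination hγsq
    rw [this, one_div_div]
  have hdiv : a * ‖w0 - wstar‖ ^ 2 / (1 - θ ^ T) ≤ 2 * (a * ‖w0 - wstar‖ ^ 2) := by
    rw [div_le_iff₀ hTpow]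
    nlinarith [mul_nonneg ha.le (sq_nonneg ‖w0 - wstar‖)]
  rw [← hγa, div_eq_mul_one_div b, ← hγb]
  nlinarith [mul_le_mul_of_nonneg_left hdiv hγ0.le]
end
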